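/- arXiv:1902.09956 — 4 statements merged into one kernel-verified Lean document; each statement's English description precedes it below -/
import Mathlib

section
/- There exists a constant C > 0 such that S(x, z) ≤ C·(x + z²) uniformly for all real x ≥ 1 and z ≥ 1. -/
open Finset MeasureTheory Filter

/-- `M(n, z) := ∑_{d ∣ n, d ≤ z} μ(d)`. -/
noncomputable def mobM (n : ℕ) (z : ℝ) : ℤ :=
  ∑ d ∈ n.divisors.filter (fun d : ℕ => (d : ℝ) ≤ z), ArithmeticFunction.moebius d

/-- `S(x, z) := ∑_{n ≤ x} M(n, z)²`. -/
noncomputable def Ssum (x z : ℝ) : ℝ :=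
  ∑ n ∈ Finset.Icc 1 ⌊x⌋₊, ((mobM n z : ℝ)) ^ 2

/-- `S(z) := ∑_{m, n ≤ z} μ(m) μ(n) / [m, n]`. -/
noncomputable def Sz (z : ℝ) : ℝ :=
  ∑ m ∈ Finset.Icc 1 ⌊z⌋₊, ∑ n ∈ Finset.Icc 1 ⌊z⌋₊,
    ((ArithmeticFunction.moebius m : ℝ) * (ArithmeticFunction.moebius n : ℝ)) / (Nat.lcm m n : ℝ)

/-- `f(n; iτ) := ∏_{p ∣ n} |1 - p^{-iτ}|²`. -/
noncomputable def fI (n : ℕ) (τ : ℝ) : ℝ :=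
  ∏ p ∈ n.primeFactors, ‖(1 : ℂ) - (p : ℂ) ^ (-(τ * Complex.I))‖ ^ 2

/-- `f(n; s) := ∏_{p ∣ n} |1 - p^{-s}|²` for complex `s`. -/
noncomputable def fC (n : ℕ) (s : ℂ) : ℝ :=
  ∏ p ∈ n.primeFactors, ‖(1 : ℂ) - (p : ℂ) ^ (-s)‖ ^ 2

/-- The constant `L`. -/
noncomputable def Lconst : ℝ :=
  (1 / (2 * Real.pi)) *
    ∫ τ : ℝ,
      (∏' p : Nat.Primes,
        (1 - 1 / ((p : ℕ) : ℝ)) * (1 + (fI (p : ℕ) τ - 1) / ((p : ℕ) : ℝ))) / τ ^ 2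

/-- `𝓛(y) := exp{(log y)^{3/5} / (log log y)^{1/5}}`. -/
noncomputable def curlyL (y : ℝ) : ℝ :=
  Real.exp ((Real.log y) ^ ((3 : ℝ) / 5) / (Real.log (Real.log y)) ^ ((1 : ℝ) / 5))

/-- `ψ(n) := ∏_{p ∣ n} (p + 1)`. -/
def psi (n : ℕ) : ℕ := ∏ p ∈ n.primeFactors, (p + 1)

/-- `ψ_m(n) := ∏_{p ∣ n, p ∤ m} (p + 1)`. -/
def psiM (m n : ℕ) : ℕ := ∏ p ∈ n.primeFactors.filter (fun p : ℕ => ¬ p ∣ m), (p + 1)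

/-- `r(n) := ∏_{p ∣ n} (1 + 2/√p)`. -/
noncomputable def rfun (n : ℕ) : ℝ := ∏ p ∈ n.primeFactors, (1 + 2 / Real.sqrt p)

/-- `k(n)`, the squarefree kernel of `n`. -/
def ker (n : ℕ) : ℕ := ∏ p ∈ n.primeFactors, p

/-- `T(y; m) := (6/π²) ∑_{d, t ≤ y} μ(d) μ(t) / ψ([d, t, m])`. -/
noncomputable def T (y : ℝ) (m : ℕ) : ℝ :=
  (6 / Real.pi ^ 2) *
    ∑ d ∈ Finset.Icc 1 ⌊y⌋₊, ∑ t ∈ Finset.Icc 1 ⌊y⌋₊,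
      ((ArithmeticFunction.moebius d : ℝ) * (ArithmeticFunction.moebius t : ℝ)) /
        (psi (Nat.lcm (Nat.lcm d t) m) : ℝ)

/-- The constant `L(m)`. -/
noncomputable def Lm (m : ℕ) : ℝ :=
  ((Nat.totient m : ℝ) ^ 2 / (2 * Real.pi * (m : ℝ) ^ 2 * (ker m : ℝ))) *
    ∫ τ : ℝ,
      (fI m τ *
        ∏' p : {p : Nat.Primes // ¬ ((p : ℕ) ∣ m)},
          (1 - 1 / ((p.1 : ℕ) : ℝ)) ^ 2 * (1 + fI (p.1 : ℕ) τ / ((p.1 : ℕ) : ℝ))) / τ ^ 2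

/-- `B := ∏_p (1 - (3p + 1)/(p (p + 1)²))`. -/
noncomputable def Bconst : ℝ :=
  ∏' p : Nat.Primes,
    (1 - (3 * ((p : ℕ) : ℝ) + 1) / (((p : ℕ) : ℝ) * (((p : ℕ) : ℝ) + 1) ^ 2))

/-- `α(n) := ∏_{p ∣ n} (1 - p/(p² + 3p + 1))`. -/
noncomputable def alpha (n : ℕ) : ℝ :=
  ∏ p ∈ n.primeFactors, (1 - (p : ℝ) / ((p : ℝ) ^ 2 + 3 * (p : ℝ) + 1))

open ArithmeticFunction in
/-- The logarithmically weighted summatory function `∑_{l ≤ n} μ(l) / l`. -/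
noncomputable def mobG (n : ℕ) : ℝ := ∑ l ∈ Ioc 0 n, (moebius l : ℝ) / l

theorem Ssum_le {x z : ℝ} (hx : 0 ≤ x) (hz : 0 ≤ z) : Ssum x z ≤ x * Sz z + z ^ 2 := by
  set N := ⌊z⌋₊ with hN
  set X := ⌊x⌋₊ with hX
  set a : ℕ → ℝ := fun d => (ArithmeticFunction.moebius d : ℝ) with ha
  have ha1 (d : ℕ) : |a d| ≤ 1 := by
    have := @ArithmeticFunction.abs_moebius_le_one d
    simp only [ha]
    exact_mod_cast this
  have h1 : ∀ n ∈ Icc 1 X, ((mobM n z : ℝ)) = ∑ d ∈ Icc 1 N, if d ∣ n then a d else 0 := by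
    intro n hn
    rw [mobM, ← sum_filter]
    push_cast
    apply sum_congr _ (fun _ _ => rfl)
    ext d
    simp only [mem_filter, Nat.mem_divisors, mem_Icc, hN, Nat.le_floor_iff hz] at *
    constructor
    · rintro ⟨⟨h, h'⟩, h2⟩
      exact ⟨⟨Nat.pos_of_dvd_of_pos h (by omega), h2⟩, h⟩
    · rintro ⟨⟨h, h'⟩, h2⟩
      exact ⟨⟨h2, by omega⟩, h'⟩
  have hcount : ∀ q : ℕ, ∑ n ∈ Icc 1 X, (if q ∣ n then (1 : ℝ) else 0) = ((X / q : ℕ) : ℝ) := by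
    intro q
    rw [← Nat.Ioc_filter_dvd_card_eq_div, ← sum_filter]
    simp
    rfl
  have h2 : Ssum x z = ∑ d ∈ Icc 1 N, ∑ e ∈ Icc 1 N, a d * a e * ((X / Nat.lcm d e : ℕ) : ℝ) := by
    rw [Ssum]
    calc _ = ∑ n ∈ Icc 1 X, ∑ d ∈ Icc 1 N, ∑ e ∈ Icc 1 N,
          a d * a e * (if Nat.lcm d e ∣ n then (1 : ℝ) else 0) := by
          apply sum_congr rfl
          intro n hn
          rw [h1 n hn, sq, sum_mul_sum]
          refine sum_congr rfl fun d _ => sum_congr rfl fun e _ => ?_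
          by_cases hd : d ∣ n <;> by_cases he : e ∣ n <;> simp [Nat.lcm_dvd_iff, hd, he]
      _ = _ := by
          rw [sum_comm]
          refine sum_congr rfl fun d _ => ?_
          rw [sum_comm]
          refine sum_congr rfl fun e _ => ?_
          rw [← mul_sum, hcount]
  have h3 : ∀ q : ℕ, |((X / q : ℕ) : ℝ) - x / q| ≤ 1 := by
    intro q
    rw [hX, ← Nat.floor_div_natCast, abs_le]
    have h0 : 0 ≤ x / q := by positivity
    have := Nat.floor_le h0
    have := Nat.lt_floor_add_one (x / q)
    constructor <;> linarith
  have h4 : Ssum x z - x * Sz z = ∑ d ∈ Icc 1 N, ∑ e ∈ Icc 1 N,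
      a d * a e * (((X / Nat.lcm d e : ℕ) : ℝ) - x / (Nat.lcm d e : ℕ)) := by
    rw [h2, Sz, mul_sum, ← sum_sub_distrib]
    refine sum_congr rfl fun d _ => ?_
    rw [mul_sum, ← sum_sub_distrib]
    refine sum_congr rfl fun e _ => ?_
    simp only [ha]
    ring
  have h5 : Ssum x z - x * Sz z ≤ ∑ d ∈ Icc 1 N, ∑ e ∈ Icc 1 N, (1 : ℝ) := by
    rw [h4]
    refine sum_le_sum fun d _ => sum_le_sum fun e _ => ?_
    refine (le_abs_self _).trans ?_
    rw [abs_mul, abs_mul]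
    exact mul_le_one₀ (mul_le_one₀ (ha1 d) (abs_nonneg _) (ha1 e)) (abs_nonneg _) (h3 _)
  have h6 : (N : ℝ) ≤ z := Nat.floor_le hz
  simp at h5
  nlinarith

open UniqueFactorizationMonoid hiding moebius in
open ArithmeticFunction in
theorem abs_sum_divisors_moebius_multiples_le (k n : ℕ) (hn : n ≠ 0) :
    |∑ d ∈ n.divisors, if k ∣ d then moebius d else 0| ≤ if radical n = k then 1 else 0 := by
  by_cases hkn : k ∣ n
  swap
  · have : ∀ d ∈ n.divisors, (if k ∣ d then moebius d else 0) = 0 := by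
      intro d hd
      rw [if_neg]
      intro h
      exact hkn (h.trans (Nat.dvd_of_mem_divisors hd))
    rw [sum_congr rfl this]
    simp
    split_ifs <;> norm_num
  by_cases hk : Squarefree k
  swap
  · have : ∀ d ∈ n.divisors, (if k ∣ d then moebius d else 0) = 0 := by
      intro d hd
      split_ifs with h
      · exact moebius_eq_zero_of_not_squarefree fun hd => hk (hd.squarefree_of_dvd h)
      · rfl
    rw [sum_congr rfl this]
    simp
    split_ifs <;> norm_num
  obtain ⟨m, hm⟩ : k ∣ radical n := (dvd_radical_iff hk.isRadical hn).2 hkn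
  have hk0 : k ≠ 0 := hk.ne_zero
  have hsq : Squarefree (k * m) := hm ▸ squarefree_radical
  have hm0 : m ≠ 0 := by rintro rfl; simp at hsq
  have key : ∑ d ∈ n.divisors, (if k ∣ d then moebius d else 0)
      = ∑ e ∈ m.divisors, moebius k * moebius e := by
    calc _ = ∑ d ∈ (k * m).divisors, (if k ∣ d then moebius d else 0) := by
          symm
          apply sum_subset
          · exact Nat.divisors_subset_of_dvd hn (hm ▸ radical_dvd_self)
          · intro d hd hd'
            split_ifs with h
            · refine moebius_eq_zero_of_not_squarefree fun hd2 => hd' ?_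
              rw [Nat.mem_divisors]
              refine ⟨?_, by simp [hk0, hm0]⟩
              rw [← hm]
              exact (dvd_radical_iff hd2.isRadical hn).2 (Nat.dvd_of_mem_divisors hd)
            · rfl
      _ = _ := by
          rw [← sum_filter]
          symm
          apply sum_bij (fun e _ => k * e)
          · intro e he
            rw [Nat.mem_divisors] at he
            simp [hk0, hm0, Nat.mul_dvd_mul_left k he.1]
          · intro a _ b _ h
            exact Nat.eq_of_mul_eq_mul_left (Nat.pos_of_ne_zero hk0) h
          · intro d hd
            simp only [mem_filter, Nat.mem_divisors] at hd
            obtain ⟨⟨h1, h2⟩, e, rfl⟩ := hd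
            exact ⟨e, by simp [hm0, Nat.dvd_of_mul_dvd_mul_left (Nat.pos_of_ne_zero hk0) h1], rfl⟩
          · intro e he
            have : Squarefree (k * e) :=
              hsq.squarefree_of_dvd (Nat.mul_dvd_mul_left k (Nat.dvd_of_mem_divisors he))
            exact (isMultiplicative_moebius.map_mul_of_coprime
              (Nat.coprime_of_squarefree_mul this)).symm
  rw [key, ← mul_sum]
  have h1 : ∑ e ∈ m.divisors, moebius e = if m = 1 then 1 else 0 := by
    rw [← coe_mul_zeta_apply, moebius_mul_coe_zeta, one_apply]
  have h2 : (radical n = k) ↔ m = 1 := by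
    rw [hm]
    constructor
    · intro h
      exact Nat.eq_of_mul_eq_mul_left (Nat.pos_of_ne_zero hk0) (by omega)
    · rintro rfl; simp
  rw [h1]
  by_cases h : m = 1
  · simp [h2, h, abs_moebius_le_one]
  · simp [h2, h]

open UniqueFactorizationMonoid in
theorem totient_mul_sum_inv_radical_eq_le (k N : ℕ) :
    (Nat.totient k : ℝ) * ∑ n ∈ Ioc 0 N with radical n = k, (1 : ℝ) / n ≤ 1 := by
  rcases Nat.eq_zero_or_pos k with rfl | hk
  · simp
  set F : ℕ →* ℝ := 
    { toFun := fun n => (n : ℝ)⁻¹, map_one' := by simp, map_mul' := by intros; simp [mul_comm] }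
  have hF : ∀ {p : ℕ}, p.Prime → ‖F p‖ < 1 := by
    intro p hp
    simp only [F, MonoidHom.coe_mk, OneHom.coe_mk, norm_inv, RCLike.norm_natCast]
    exact inv_lt_one_of_one_lt₀ (by exact_mod_cast hp.one_lt)
  obtain ⟨hs, hsum⟩ := EulerProduct.summable_and_hasSum_factoredNumbers_prod_filter_prime_geometric
    hF k.primeFactors
  have hprod : ∏ p ∈ k.primeFactors with p.Prime, (1 - F p)⁻¹ = k / (Nat.totient k : ℝ) := by
    have h0 : (∏ p ∈ k.primeFactors, (1 - (p : ℝ)⁻¹)) ≠ 0 := by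
      rw [prod_ne_zero_iff]
      intro p hp
      have : (1 : ℝ) < p := by exact_mod_cast (Nat.prime_of_mem_primeFactors hp).one_lt
      have := inv_lt_one_of_one_lt₀ this
      linarith
    have h1 := Nat.totient_eq_mul_prod_factors k
    have h2 : (Nat.totient k : ℝ) = k * ∏ p ∈ k.primeFactors, (1 - (p : ℝ)⁻¹) := by
      have h3 := congrArg (fun q : ℚ => (q : ℝ)) h1
      push_cast at h3
      exact h3
    have : k.primeFactors.filter Nat.Prime = k.primeFactors :=
      filter_true_of_mem fun p hp => Nat.prime_of_mem_primeFactors hp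
    rw [this, h2, prod_inv_distrib]
    simp only [F, MonoidHom.coe_mk, OneHom.coe_mk]
    have : (k : ℝ) ≠ 0 := by positivity
    field_simp
  rw [hprod] at hsum
  have hphi : (0 : ℝ) < Nat.totient k := by exact_mod_cast Nat.totient_pos.2 hk
  have hle : ∑ n ∈ Ioc 0 N with radical n = k, (k : ℝ) / n ≤ k / (Nat.totient k : ℝ) := by
    rw [← hsum.tsum_eq]
    set S := (Ioc 0 N).filter (fun n => radical n = k)
    have hS : ∀ n ∈ S, n / k ∈ Nat.factoredNumbers k.primeFactors ∧ k * (n / k) = n := by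
      intro n hn
      simp only [S, mem_filter, mem_Ioc] at hn
      obtain ⟨⟨hn0, -⟩, rfl⟩ := hn
      have hd : radical n ∣ n := radical_dvd_self
      refine ⟨?_, Nat.mul_div_cancel' hd⟩
      rw [Nat.mem_factoredNumbers']
      intro p hp hpd
      have : p ∣ n := hpd.trans (Nat.div_dvd_of_dvd hd)
      rw [Nat.mem_primeFactors]
      refine ⟨hp, ?_, radical_ne_zero⟩
      exact (dvd_radical_iff_of_irreducible hp (by omega)).2 this
    have := hs.of_norm.sum_le_tsum (S.attach.image (fun n => (⟨n.1 / k, (hS n.1 n.2).1⟩ :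
      Nat.factoredNumbers k.primeFactors))) (fun i _ => by simp [F])
    refine le_trans (le_of_eq ?_) this
    rw [sum_image]
    · rw [← sum_attach]
      refine sum_congr rfl fun n _ => ?_
      simp only [F, MonoidHom.coe_mk, OneHom.coe_mk]
      rw [Nat.cast_div ⟨_, (hS n.1 n.2).2.symm⟩ (by positivity), inv_div]
    · intro a _ b _ h
      simp only [Subtype.mk.injEq] at h
      ext
      rw [← (hS a.1 a.2).2, ← (hS b.1 b.2).2, h]
  have hk' : (0 : ℝ) < k := by exact_mod_cast hk
  have : ∑ n ∈ Ioc 0 N with radical n = k, (k : ℝ) / n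
      = k * ∑ n ∈ Ioc 0 N with radical n = k, (1 : ℝ) / n := by
    rw [mul_sum]
    refine sum_congr rfl fun n _ => by ring
  rw [this, le_div_iff₀ hphi] at hle
  nlinarith

open UniqueFactorizationMonoid hiding moebius in
open ArithmeticFunction in
theorem Sz_le_sum_mobG (z : ℝ) :
    Sz z ≤ ∑ n ∈ Ioc 0 ⌊z⌋₊, mobG (⌊z⌋₊ / n) ^ 2 / n := by
  set N := ⌊z⌋₊ with hN
  set h : ℕ → ℝ := fun k => ∑ m ∈ Ioc 0 N, (if k ∣ m then (moebius m : ℝ) else 0) / m with hh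
  have hSz : Sz z = ∑ k ∈ Ioc 0 N, (Nat.totient k : ℝ) * h k ^ 2 := by
    have e1 : ∀ m ∈ Ioc 0 N, ∀ n ∈ Ioc 0 N, ((moebius m : ℝ) * moebius n) / (Nat.lcm m n : ℝ)
        = ∑ k ∈ Ioc 0 N, (Nat.totient k : ℝ) * (((if k ∣ m then (moebius m : ℝ) else 0) / m) *
          ((if k ∣ n then (moebius n : ℝ) else 0) / n)) := by
      intro m hm n hn
      rw [mem_Ioc] at hm hn
      have hg : (Nat.gcd m n : ℝ) = ∑ k ∈ Ioc 0 N, if k ∣ m ∧ k ∣ n then (Nat.totient k : ℝ) else 0 := by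
        rw [← sum_filter]
        have := Nat.sum_totient (Nat.gcd m n)
        rw [← this]
        push_cast
        apply sum_congr _ (fun _ _ => rfl)
        ext k
        simp only [Nat.mem_divisors, mem_filter, mem_Ioc, Nat.dvd_gcd_iff]
        constructor
        · rintro ⟨h1, h2⟩
          exact ⟨⟨Nat.pos_of_dvd_of_pos h1.1 hm.1, (Nat.le_of_dvd hm.1 h1.1).trans hm.2⟩, h1⟩
        · rintro ⟨h1, h2⟩
          exact ⟨h2, (Nat.gcd_pos_of_pos_left _ hm.1).ne'⟩
      have hl : (Nat.gcd m n : ℝ) * Nat.lcm m n = m * n := by exact_mod_cast Nat.gcd_mul_lcm m n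
      have hm0 : (m : ℝ) ≠ 0 := by exact_mod_cast hm.1.ne'
      have hn0 : (n : ℝ) ≠ 0 := by exact_mod_cast hn.1.ne'
      have hl0 : (Nat.lcm m n : ℝ) ≠ 0 := by
        exact_mod_cast Nat.lcm_ne_zero hm.1.ne' hn.1.ne'
      have : ((moebius m : ℝ) * moebius n) / (Nat.lcm m n : ℝ) =
          (Nat.gcd m n : ℝ) * ((moebius m : ℝ) * moebius n / (m * n)) := by
        rw [← hl]
        have : (Nat.gcd m n : ℝ) ≠ 0 := by
          exact_mod_cast (Nat.gcd_pos_of_pos_left _ hm.1).ne'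
        field_simp
      rw [this, hg, sum_mul]
      refine sum_congr rfl fun k _ => ?_
      by_cases h1 : k ∣ m <;> by_cases h2 : k ∣ n <;> simp [h1, h2]
      left
      field_simp
    rw [Sz]
    change ∑ m ∈ Ioc 0 N, ∑ n ∈ Ioc 0 N, _ = _
    rw [sum_congr rfl fun m hm => sum_congr rfl fun n hn => e1 m hm n hn]
    rw [sum_congr rfl fun m hm => sum_comm, sum_comm]
    refine sum_congr rfl fun k _ => ?_
    simp only [hh, sq, sum_mul_sum]
    simp only [mul_sum]
  set u : ℕ → ℕ → ℝ := fun k n => ∑ d ∈ n.divisors, if k ∣ d then (moebius d : ℝ) else 0 with hu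
  have hu1 : ∀ k n, n ≠ 0 → |u k n| ≤ if radical n = k then 1 else 0 := by
    intro k n hn
    have := abs_sum_divisors_moebius_multiples_le k n hn
    simp only [hu]
    exact_mod_cast this
  have hhk : ∀ k, h k = ∑ n ∈ Ioc 0 N, u k n / n * mobG (N / n) := by
    intro k
    set A : ArithmeticFunction ℝ := ⟨fun m => if k ∣ m then (moebius m : ℝ) else 0, by simp⟩ with hA
    set R : ArithmeticFunction ℝ := ⟨fun m => ((m : ℝ))⁻¹, by simp⟩ with hR
    have hinv : (A * (zeta : ArithmeticFunction ℝ)) * (moebius : ArithmeticFunction ℝ) = A := by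
      rw [mul_assoc, coe_zeta_mul_coe_moebius, mul_one]
    have hdist : ∀ f g : ArithmeticFunction ℝ, R.pmul (f * g) = R.pmul f * R.pmul g := by
      intro f g
      ext n
      simp only [pmul_apply, mul_apply, mul_sum]
      refine sum_congr rfl fun p hp => ?_
      rw [← (Nat.mem_divisorsAntidiagonal.1 hp).1]
      simp only [hR, coe_mk]
      push_cast
      rw [mul_inv]
      ring
    have e1 : h k = ∑ m ∈ Ioc 0 N, (R.pmul A) m := by
      refine sum_congr rfl fun m _ => ?_
      rw [pmul_apply]
      simp only [hA, hR, coe_mk]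
      ring
    rw [e1, ← hinv, hdist, sum_Ioc_mul_eq_sum_sum]
    refine sum_congr rfl fun n _ => ?_
    rw [mobG]
    have : (R.pmul (A * (zeta : ArithmeticFunction ℝ))) n = u k n / n := by
      rw [pmul_apply, coe_mul_zeta_apply]
      simp only [hR, hA, coe_mk, hu]
      ring
    rw [this]
    congr 1
    refine sum_congr rfl fun l _ => ?_
    rw [pmul_apply]
    simp only [hR, coe_mk, intCoe_apply]
    ring
  have hcs : ∀ k, (Nat.totient k : ℝ) * h k ^ 2 ≤
      ∑ n ∈ Ioc 0 N with radical n = k, mobG (N / n) ^ 2 / n := by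
    intro k
    set S := (Ioc 0 N).filter (fun n => radical n = k) with hS
    have e1 : h k = ∑ n ∈ S, u k n / n * mobG (N / n) := by
      rw [hhk, hS, sum_filter]
      refine sum_congr rfl fun n hn => ?_
      split_ifs with h1
      · rfl
      · have := hu1 k n (by rw [mem_Ioc] at hn; omega)
        rw [if_neg h1, abs_nonpos_iff] at this
        rw [this]; simp
    have e2 : h k ^ 2 ≤ (∑ n ∈ S, (1 : ℝ) / n) * ∑ n ∈ S, mobG (N / n) ^ 2 / n := by
      rw [e1]
      apply sum_sq_le_sum_mul_sum_of_sq_le_mul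
      · intros; positivity
      · intros; positivity
      · intro n hn
        have hn' : n ≠ 0 := by
          simp only [hS, mem_filter, mem_Ioc] at hn
          omega
        have h1 := hu1 k n hn'
        have h2 : |u k n| ≤ 1 := h1.trans (by split_ifs <;> norm_num)
        have h3 : u k n ^ 2 ≤ 1 := by rwa [sq_le_one_iff_abs_le_one]
        have : (u k n / n * mobG (N / n)) ^ 2 = u k n ^ 2 * (1 / n * (mobG (N / n) ^ 2 / n)) := by
          ring
        rw [this]
        exact mul_le_of_le_one_left (by positivity) h3
    have e3 := totient_mul_sum_inv_radical_eq_le k N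
    have e4 : 0 ≤ ∑ n ∈ S, mobG (N / n) ^ 2 / n := sum_nonneg fun _ _ => by positivity
    calc _ ≤ (Nat.totient k : ℝ) * ((∑ n ∈ S, (1 : ℝ) / n) * ∑ n ∈ S, mobG (N / n) ^ 2 / n) := by
          gcongr
      _ = ((Nat.totient k : ℝ) * ∑ n ∈ S, (1 : ℝ) / n) * ∑ n ∈ S, mobG (N / n) ^ 2 / n := by ring
      _ ≤ _ := mul_le_of_le_one_left e4 e3
  rw [hSz]
  refine (sum_le_sum fun k _ => hcs k).trans ?_
  simp only [sum_filter]
  rw [sum_comm]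
  refine sum_le_sum fun n _ => ?_
  rw [sum_ite_eq]
  split_ifs
  · rfl
  · positivity

open ArithmeticFunction in
theorem abs_mobG_le_one (N : ℕ) : |mobG N| ≤ 1 := by
  rcases Nat.eq_zero_or_pos N with rfl | hN
  · simp [mobG]
  have h1 : ∑ n ∈ Ioc 0 N, (moebius n : ℝ) * ((N / n : ℕ) : ℝ) = 1 := by
    have := sum_Ioc_mul_zeta_eq_sum (moebius : ArithmeticFunction ℝ) N
    rw [coe_moebius_mul_coe_zeta] at this
    simp only [intCoe_apply] at this
    rw [← this]
    simp only [one_apply]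
    rw [sum_ite_eq']
    simp; omega
  have hN' : (0 : ℝ) < N := by exact_mod_cast hN
  have h2 : N * mobG N - 1 = ∑ n ∈ Ioc 1 N, (moebius n : ℝ) * ((N : ℝ) / n - ((N / n : ℕ) : ℝ)) := by
    have : ∑ n ∈ Ioc 1 N, (moebius n : ℝ) * ((N : ℝ) / n - ((N / n : ℕ) : ℝ))
        = ∑ n ∈ Ioc 0 N, (moebius n : ℝ) * ((N : ℝ) / n - ((N / n : ℕ) : ℝ)) := by
      apply sum_subset (Ioc_subset_Ioc_left (by norm_num))
      intro n hn hn'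
      simp only [mem_Ioc] at hn hn'
      obtain rfl : n = 1 := by omega
      simp
    rw [this, ← h1, mobG, mul_sum, ← sum_sub_distrib]
    refine sum_congr rfl fun n _ => by ring
  have h3 : |N * mobG N - 1| ≤ N - 1 := by
    rw [h2]
    refine (abs_sum_le_sum_abs _ _).trans ?_
    have : ∀ n ∈ Ioc 1 N, |(moebius n : ℝ) * ((N : ℝ) / n - ((N / n : ℕ) : ℝ))| ≤ 1 := by
      intro n _
      rw [abs_mul]
      refine mul_le_one₀ (by exact_mod_cast @abs_moebius_le_one n) (abs_nonneg _) ?_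
      rw [← @Nat.floor_div_eq_div ℝ, abs_le]
      have h0 : (0 : ℝ) ≤ N / n := by positivity
      have := Nat.floor_le h0
      have := Nat.lt_floor_add_one ((N : ℝ) / n)
      constructor <;> linarith
    refine (sum_le_sum this).trans ?_
    simp
    rw [Nat.cast_sub hN]
    simp
  have h4 : |N * mobG N| ≤ N := by
    have : |(N * mobG N - 1) + 1| ≤ _ := abs_add_le _ _
    rw [sub_add_cancel, abs_one] at this
    linarith
  rw [abs_mul, abs_of_pos hN'] at h4
  nlinarith

theorem abs_mobG_sub_le {a b : ℕ} (h : b ≤ a) :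
    |mobG a - mobG b| ≤ ((a : ℝ) - b) / (b + 1) := by
  have h1 : mobG a - mobG b = ∑ l ∈ Ioc b a, (ArithmeticFunction.moebius l : ℝ) / l := by
    rw [mobG, mobG, sub_eq_iff_eq_add, add_comm]
    exact (sum_Ioc_consecutive _ (Nat.zero_le b) h).symm
  rw [h1]
  refine (abs_sum_le_sum_abs _ _).trans ?_
  have : ∀ l ∈ Ioc b a, |(ArithmeticFunction.moebius l : ℝ) / l| ≤ 1 / (b + 1) := by
    intro l hl
    rw [mem_Ioc] at hl
    have h2 : ((b + 1 : ℕ) : ℝ) ≤ l := by exact_mod_cast hl.1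
    push_cast at h2
    rw [abs_div, Nat.abs_cast]
    have : |(ArithmeticFunction.moebius l : ℝ)| ≤ 1 := by
      exact_mod_cast @ArithmeticFunction.abs_moebius_le_one l
    gcongr
  refine (sum_le_sum this).trans ?_
  simp
  rw [Nat.cast_sub h]
  exact le_of_eq (by ring)

theorem measurable_mobG_floor_exp (c : ℝ) :
    Measurable fun v : ℝ => mobG ⌊Real.exp (c * v)⌋₊ :=
  (measurable_from_nat (f := mobG)).comp
    (Nat.measurable_floor.comp (Real.measurable_exp.comp (measurable_const_mul c)))

theorem mobG_div_sq_le {N n : ℕ} (hn : 0 < n) (hnN : n ≤ N) {w : ℝ}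
    (h1 : (N : ℝ) / (n + 1) ≤ w) (h2 : w ≤ (N : ℝ) / n) :
    mobG (N / n) ^ 2 ≤ 2 * mobG ⌊w⌋₊ ^ 2 + 2 * (1 / n + 2 * n / N) ^ 2 := by
  have hn' : (0 : ℝ) < n := by exact_mod_cast hn
  have hN' : (0 : ℝ) < N := by exact_mod_cast hn.trans_le hnN
  have hw : 0 < w := lt_of_lt_of_le (by positivity) h1
  have hle : ⌊w⌋₊ ≤ N / n := by
    rw [← @Nat.floor_div_eq_div ℝ]
    exact Nat.floor_le_floor h2
  have hd := abs_mobG_sub_le hle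
  have h3 : (((N / n : ℕ) : ℝ) - ⌊w⌋₊) / (⌊w⌋₊ + 1) ≤ 1 / n + 2 * n / N := by
    have ha : ((N / n : ℕ) : ℝ) ≤ N / n := Nat.cast_div_le
    have hb := Nat.lt_floor_add_one w
    have hb' := Nat.floor_le hw.le
    have hc : (N : ℝ) / n ≤ w + w / n := by
      rw [div_le_iff₀ (by positivity)] at h1
      rw [div_le_iff₀ hn']
      field_simp
      linarith
    have h4 : (1 : ℝ) ≤ 2 * n / N * w := by
      rw [div_le_iff₀ (by positivity)] at h1
      rw [div_mul_eq_mul_div, le_div_iff₀ hN']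
      have : (1 : ℝ) ≤ n := by exact_mod_cast hn
      nlinarith
    calc _ ≤ (w / n + 1) / (⌊w⌋₊ + 1 : ℝ) := by
          gcongr
          linarith
      _ ≤ (w / n + 1) / w := by gcongr
      _ ≤ (w / n + 2 * n / N * w) / w := by gcongr
      _ = _ := by field_simp
  have h5 := hd.trans h3
  set e := (1 : ℝ) / n + 2 * n / N
  have h6 : (mobG (N / n) - mobG ⌊w⌋₊) ^ 2 ≤ e ^ 2 := by
    rw [← sq_abs]
    gcongr
  nlinarith [sq_nonneg (mobG (N / n) - 2 * mobG ⌊w⌋₊)]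

theorem sum_Ioc_zero_eq_sum_range_succ (f : ℕ → ℝ) (N : ℕ) :
    ∑ n ∈ Ioc 0 N, f n = ∑ n ∈ range N, f (n + 1) := by
  induction N with
  | zero => simp
  | succ k ih => rw [sum_Ioc_succ_top (Nat.zero_le k), sum_range_succ, ih]

theorem sum_mobG_div_sq_le (N : ℕ) (hN : 0 < N) :
    ∑ n ∈ Ioc 0 N, mobG (N / n) ^ 2 / n ≤ 50 +
      4 * ∫ v in Real.log ((N : ℝ) / (N + 1))..Real.log N, mobG ⌊Real.exp v⌋₊ ^ 2 := by
  set H : ℝ → ℝ := fun v => mobG ⌊Real.exp v⌋₊ ^ 2 with hH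
  have hN' : (0 : ℝ) < N := by exact_mod_cast hN
  have hint : ∀ a b, IntervalIntegrable H volume a b := by
    intro a b
    refine (intervalIntegrable_const (c := (1 : ℝ))).mono_fun ?_ ?_
    · have := (measurable_mobG_floor_exp 1).pow_const 2
      simp only [one_mul] at this
      exact this.aestronglyMeasurable
    · refine Eventually.of_forall fun v => ?_
      simp only [hH, norm_pow, Real.norm_eq_abs, norm_one]
      exact pow_le_one₀ (abs_nonneg _) (abs_mobG_le_one _)
  set a : ℕ → ℝ := fun n => Real.log ((N : ℝ) / (n + 1)) with ha
  have hstep : ∀ n ∈ range N, mobG (N / (n + 1)) ^ 2 / ((n + 1 : ℕ) : ℝ) ≤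
      4 * (∫ v in a (n + 1)..a n, H v)
        + 4 * (1 / ((n + 1 : ℕ) : ℝ)) * (1 / ((n + 1 : ℕ) : ℝ) + 2 * ((n + 1 : ℕ) : ℝ) / N) ^ 2 := by
    intro n hn
    rw [mem_range] at hn
    set m := n + 1 with hm
    have hm0 : (0 : ℝ) < m := by positivity
    have hanm : a n = Real.log ((N : ℝ) / m) := by simp [ha, hm]
    have hdiff : a n - a m = Real.log ((m + 1) / m) := by
      rw [hanm, ha]
      simp only
      rw [← Real.log_div (by positivity) (by positivity)]
      congr 1
      field_simp
    have hlo : 1 / (2 * (m : ℝ)) ≤ a n - a m := by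
      rw [hdiff]
      have := Real.one_sub_inv_le_log_of_pos (x := ((m : ℝ) + 1) / m) (by positivity)
      refine le_trans ?_ this
      have h1m : (1 : ℝ) ≤ m := by exact_mod_cast (by omega : 1 ≤ m)
      have : 1 - (((m : ℝ) + 1) / m)⁻¹ = 1 / (m + 1) := by field_simp; ring
      rw [this]
      gcongr
      linarith
    have hhi : a n - a m ≤ 1 / m := by
      rw [hdiff]
      refine (Real.log_le_sub_one_of_pos (by positivity)).trans (le_of_eq ?_)
      field_simp
      ring
    have hle : a m ≤ a n := by
      have : (0 : ℝ) < 1 / (2 * m) := by positivity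
      linarith
    set e := (1 : ℝ) / m + 2 * m / N
    have hI : (a n - a m) * mobG (N / m) ^ 2 ≤ 2 * (∫ v in a m..a n, H v) + (a n - a m) * (2 * e ^ 2) := by
      have : ∫ v in a m..a n, mobG (N / m) ^ 2 ≤ ∫ v in a m..a n, (2 * H v + 2 * e ^ 2) := by
        apply intervalIntegral.integral_mono_on hle intervalIntegrable_const
          (((hint _ _).const_mul 2).add intervalIntegrable_const)
        intro v hv
        apply mobG_div_sq_le (by omega) (by omega)
        · rw [← Real.log_le_iff_le_exp (by positivity)]
          exact hv.1
        · rw [← Real.le_log_iff_exp_le (by positivity), ← hanm]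
          exact hv.2
      rw [intervalIntegral.integral_add ((hint _ _).const_mul 2) intervalIntegrable_const,
        intervalIntegral.integral_const, intervalIntegral.integral_const,
        intervalIntegral.integral_const_mul] at this
      simpa using this
    have hI2 : (a n - a m) * (2 * e ^ 2) ≤ 1 / m * (2 * e ^ 2) := by gcongr
    have hI3 : 1 / (2 * (m : ℝ)) * mobG (N / m) ^ 2 ≤ (a n - a m) * mobG (N / m) ^ 2 := by gcongr
    have : mobG (N / m) ^ 2 / (m : ℝ) = 2 * (1 / (2 * (m : ℝ)) * mobG (N / m) ^ 2) := by
      field_simp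
    rw [this]
    linarith
  have hsum : ∑ n ∈ Ioc 0 N, mobG (N / n) ^ 2 / (n : ℝ) =
      ∑ n ∈ range N, mobG (N / (n + 1)) ^ 2 / ((n + 1 : ℕ) : ℝ) := by
    exact sum_Ioc_zero_eq_sum_range_succ (fun n => mobG (N / n) ^ 2 / (n : ℝ)) N
  have hadj : ∑ n ∈ range N, ∫ v in a (n + 1)..a n, H v = ∫ v in a N..a 0, H v := by
    have := intervalIntegral.sum_integral_adjacent_intervals (f := H) (a := a) (n := N)
      (μ := volume) (fun k _ => hint _ _)
    rw [intervalIntegral.integral_symm, ← this, ← sum_neg_distrib]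
    exact sum_congr rfl fun n _ => intervalIntegral.integral_symm _ _
  have ha0 : a 0 = Real.log N := by simp [ha]
  have herr : ∑ n ∈ range N, 4 * (1 / ((n + 1 : ℕ) : ℝ)) *
      (1 / ((n + 1 : ℕ) : ℝ) + 2 * ((n + 1 : ℕ) : ℝ) / N) ^ 2 ≤ 50 := by
    have h1 : ∀ n ∈ range N, 4 * (1 / ((n + 1 : ℕ) : ℝ)) *
      (1 / ((n + 1 : ℕ) : ℝ) + 2 * ((n + 1 : ℕ) : ℝ) / N) ^ 2 ≤
        8 * (1 / ((n + 1 : ℕ) : ℝ) ^ 2) + 32 * (1 / N) := by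
      intro n hn
      rw [mem_range] at hn
      set m := n + 1 with hm
      have h1m : (1 : ℝ) ≤ m := by exact_mod_cast (by omega : 1 ≤ m)
      have hmN : (m : ℝ) ≤ N := by exact_mod_cast (by omega : m ≤ N)
      have h2 : (1 / (m : ℝ) + 2 * m / N) ^ 2 ≤ 2 * (1 / (m : ℝ)) ^ 2 + 2 * (2 * m / N) ^ 2 := by
        nlinarith [sq_nonneg (1 / (m : ℝ) - 2 * m / N)]
      calc _ ≤ 4 * (1 / (m : ℝ)) * (2 * (1 / (m : ℝ)) ^ 2 + 2 * (2 * m / N) ^ 2) := by gcongr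
        _ = 8 * (1 / (m : ℝ) ^ 2 * (1 / m)) + 32 * (1 / N * (m / N)) := by field_simp; ring
        _ ≤ 8 * (1 / (m : ℝ) ^ 2 * 1) + 32 * (1 / N * 1) := by
          gcongr
          · rw [div_le_one (by positivity)]; exact h1m
          · rw [div_le_one (by positivity)]; exact hmN
        _ = _ := by ring
    refine (sum_le_sum h1).trans ?_
    rw [sum_add_distrib, ← mul_sum]
    have h2 : ∑ n ∈ range N, (1 / ((n + 1 : ℕ) : ℝ) ^ 2) ≤ 2 := by
      rw [← sum_Ioc_zero_eq_sum_range_succ (fun n => 1 / (n : ℝ) ^ 2) N,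
        ← sum_Ioc_consecutive _ (Nat.zero_le 1) hN]
      have := sum_Ioc_inv_sq_le_sub (α := ℝ) one_ne_zero hN
      have hpos : (0 : ℝ) ≤ (N : ℝ)⁻¹ := by positivity
      simp only [one_div]
      norm_num at this ⊢
      linarith
    have h3 : ∑ n ∈ range N, 32 * (1 / (N : ℝ)) = 32 := by
      simp
      field_simp
    rw [h3]
    linarith
  rw [hsum]
  refine (sum_le_sum hstep).trans ?_
  rw [sum_add_distrib, ← mul_sum, hadj, ha0]
  linarith

/-- The difference between `m ^ (-s)` and the integral of `u ^ (-s)` over `[m, m + 1]`. -/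
noncomputable def zetaTerm (m : ℕ) (s : ℂ) : ℂ :=
  (m : ℂ) ^ (-s) - (((m + 1 : ℕ) : ℂ) ^ (1 - s) - (m : ℂ) ^ (1 - s)) / (1 - s)

theorem zetaTerm_eq_integral {m : ℕ} (hm : 0 < m) {s : ℂ} (hs : s ≠ 1) :
    zetaTerm m s = ∫ u : ℝ in (m : ℝ)..(m + 1 : ℕ), ((m : ℂ) ^ (-s) - (u : ℂ) ^ (-s)) := by
  have hm' : (0 : ℝ) < m := by exact_mod_cast hm
  have h0 : (0 : ℝ) ∉ Set.uIcc (m : ℝ) (m + 1 : ℕ) := by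
    rw [Set.uIcc_of_le (by push_cast; linarith)]
    intro h
    linarith [h.1]
  have hs' : -s ≠ -1 := fun h => hs (neg_injective h)
  rw [intervalIntegral.integral_sub intervalIntegrable_const
    (intervalIntegral.intervalIntegrable_cpow (Or.inr h0)),
    intervalIntegral.integral_const, integral_cpow (Or.inr ⟨hs', h0⟩), zetaTerm]
  push_cast
  simp [neg_add_eq_sub]

theorem norm_natCast_cpow_sub_ofReal_cpow_le {m : ℕ} (hm : 0 < m) {s : ℂ} (hs : 0 ≤ s.re) {u : ℝ}
    (hu : u ∈ Set.Icc (m : ℝ) (m + 1 : ℕ)) :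
    ‖(m : ℂ) ^ (-s) - (u : ℂ) ^ (-s)‖ ≤ ‖s‖ * (m : ℝ) ^ (-s.re - 1) := by
  have hm' : (0 : ℝ) < m := by exact_mod_cast hm
  have key := (convex_Icc (m : ℝ) (m + 1 : ℕ)).norm_image_sub_le_of_norm_hasDerivWithin_le
    (f := fun v : ℝ => (v : ℂ) ^ (-s)) (f' := fun v : ℝ => -s * (v : ℂ) ^ (-s - 1))
    (C := ‖s‖ * (m : ℝ) ^ (-s.re - 1)) (x := u) (y := m) ?_ ?_ hu (by simp)
  · refine key.trans (mul_le_of_le_one_right (by positivity) ?_)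
    have := hu.2
    push_cast at this
    rw [Real.norm_eq_abs, abs_le]
    constructor <;> linarith [hu.1]
  · intro v hv
    have hv' : 0 < v := hm'.trans_le hv.1
    have := ((hasDerivAt_id (v : ℂ)).cpow_const (c := -s)
      (Complex.ofReal_mem_slitPlane.2 hv')).comp_ofReal
    simpa using this.hasDerivWithinAt
  · intro v hv
    have hv' : 0 < v := hm'.trans_le hv.1
    rw [norm_mul, norm_neg, Complex.norm_cpow_eq_rpow_re_of_pos hv']
    gcongr ?_ * ?_
    simp only [Complex.sub_re, Complex.neg_re, Complex.one_re]
    exact Real.rpow_le_rpow_of_nonpos hm' hv.1 (by linarith)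

theorem norm_zetaTerm_le {m : ℕ} (hm : 0 < m) {s : ℂ} (hs : 0 ≤ s.re) (hs1 : s ≠ 1) {θ : ℝ}
    (h0 : 0 ≤ θ) (h1 : θ ≤ 1) :
    ‖zetaTerm m s‖ ≤ 2 * ‖s‖ ^ θ * (m : ℝ) ^ (-s.re - θ) := by
  have hm' : (0 : ℝ) < m := by exact_mod_cast hm
  have hs0 : ‖zetaTerm m s‖ ≤ min (2 * (m : ℝ) ^ (-s.re)) (‖s‖ * (m : ℝ) ^ (-s.re - 1)) := by
    rw [zetaTerm_eq_integral hm hs1]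
    have := intervalIntegral.norm_integral_le_of_norm_le_const (a := (m : ℝ)) (b := (m + 1 : ℕ))
      (f := fun u : ℝ => ((m : ℂ) ^ (-s) - (u : ℂ) ^ (-s)))
      (C := min (2 * (m : ℝ) ^ (-s.re)) (‖s‖ * (m : ℝ) ^ (-s.re - 1))) ?_
    · simpa using this
    · intro u hu
      rw [Set.uIoc_of_le (by push_cast; linarith)] at hu
      have hu' : 0 < u := hm'.trans hu.1
      refine le_min ?_ (norm_natCast_cpow_sub_ofReal_cpow_le hm hs ⟨hu.1.le, hu.2⟩)
      refine (norm_sub_le _ _).trans ?_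
      rw [Complex.norm_cpow_eq_rpow_re_of_pos hu', ← Complex.ofReal_natCast,
        Complex.norm_cpow_eq_rpow_re_of_pos hm', Complex.neg_re]
      have : u ^ (-s.re) ≤ (m : ℝ) ^ (-s.re) :=
        Real.rpow_le_rpow_of_nonpos hm' hu.1.le (by linarith)
      linarith
  refine hs0.trans ?_
  have e1 : (m : ℝ) ^ (-s.re - 1) = (m : ℝ) ^ (-s.re) / m := by
    rw [Real.rpow_sub_one hm'.ne']
  have e2 : 2 * ‖s‖ ^ θ * (m : ℝ) ^ (-s.re - θ) = (m : ℝ) ^ (-s.re) * (2 * (‖s‖ / m) ^ θ) := by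
    rw [Real.rpow_sub hm', Real.div_rpow (norm_nonneg _) hm'.le]
    ring
  rw [e2]
  have hX : 0 < (m : ℝ) ^ (-s.re) := by positivity
  rcases le_total 1 (‖s‖ / m) with h | h
  · refine (min_le_left _ _).trans ?_
    have := Real.one_le_rpow h h0
    nlinarith
  · refine (min_le_right _ _).trans ?_
    have hq : 0 ≤ ‖s‖ / m := by positivity
    have : ‖s‖ / m ≤ 2 * (‖s‖ / m) ^ θ := by
      rcases hq.eq_or_lt with h' | h'
      · rw [← h']; positivity
      have := Real.rpow_le_rpow_of_exponent_ge h' h h1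
      rw [Real.rpow_one] at this
      have := Real.rpow_nonneg hq θ
      linarith
    rw [e1]
    calc ‖s‖ * ((m : ℝ) ^ (-s.re) / m) = (m : ℝ) ^ (-s.re) * (‖s‖ / m) := by ring
      _ ≤ _ := by gcongr

theorem summable_succ_rpow_neg {p : ℝ} (hp : 1 < p) :
    Summable fun n : ℕ => (((n + 1 : ℕ) : ℝ) ^ (-p)) :=
  (summable_nat_add_iff 1).2 (Real.summable_nat_rpow.2 (by linarith))

theorem hasSum_zetaTerm {s : ℂ} (hs : 1 < s.re) :
    HasSum (fun n : ℕ => zetaTerm (n + 1) s) (riemannZeta s - 1 / (s - 1)) := by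
  have hs1 : s ≠ 1 := by rintro rfl; simp at hs
  have hsum : Summable fun n : ℕ => zetaTerm (n + 1) s := by
    refine Summable.of_norm_bounded (g := fun n : ℕ => 2 * ‖s‖ ^ (0 : ℝ) * (((n + 1 : ℕ) : ℝ) ^ (-s.re)))
      ((summable_succ_rpow_neg hs).mul_left _) fun n => ?_
    simpa using norm_zetaTerm_le n.succ_pos (by linarith) hs1 le_rfl zero_le_one
  have hz : HasSum (fun n : ℕ => (((n + 1 : ℕ) : ℂ)) ^ (-s)) (riemannZeta s) := by
    have h1 : Summable (fun n : ℕ => (((n + 1 : ℕ) : ℂ)) ^ (-s)) := by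
      have := (summable_nat_add_iff 1).2 (Complex.summable_one_div_nat_cpow.2 hs)
      simpa [Complex.cpow_neg] using this
    rw [zeta_eq_tsum_one_div_nat_add_one_cpow hs]
    convert h1.hasSum using 3 with n
    simp [Complex.cpow_neg]
  have hlim : Tendsto (fun N : ℕ => ∑ n ∈ range N, zetaTerm (n + 1) s) atTop
      (nhds (riemannZeta s - 1 / (s - 1))) := by
    have e : ∀ N : ℕ, ∑ n ∈ range N, zetaTerm (n + 1) s =
        ∑ n ∈ range N, (((n + 1 : ℕ) : ℂ)) ^ (-s)
          - ((((N + 1 : ℕ) : ℂ)) ^ (1 - s) - 1) / (1 - s) := by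
      intro N
      simp only [zetaTerm]
      rw [sum_sub_distrib, ← sum_div,
        sum_range_sub (fun n => (((n + 1 : ℕ) : ℂ)) ^ (1 - s))]
      simp
    simp only [e]
    have h0 : Tendsto (fun N : ℕ => (((N + 1 : ℕ) : ℂ)) ^ (1 - s)) atTop (nhds 0) := by
      rw [tendsto_zero_iff_norm_tendsto_zero]
      have : ∀ N : ℕ, ‖(((N + 1 : ℕ) : ℂ)) ^ (1 - s)‖ = ((N + 1 : ℕ) : ℝ) ^ (-(s.re - 1)) := by
        intro N
        rw [← Complex.ofReal_natCast, Complex.norm_cpow_eq_rpow_re_of_pos (by positivity)]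
        simp
      simp only [this]
      exact (tendsto_rpow_neg_atTop (by linarith)).comp
        (tendsto_natCast_atTop_atTop.comp (tendsto_add_atTop_nat 1))
    convert hz.tendsto_sum_nat.sub ((h0.sub_const 1).div_const (1 - s)) using 2
    have : s - 1 ≠ 0 := sub_ne_zero.2 hs1
    have : 1 - s ≠ 0 := sub_ne_zero.2 hs1.symm
    field_simp
    ring
  rwa [hsum.hasSum_iff_tendsto_nat]

theorem differentiableAt_zetaTerm {m : ℕ} (hm : 0 < m) {s : ℂ} (hs : s ≠ 1) :
    DifferentiableAt ℂ (zetaTerm m) s := by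
  have hm' : (m : ℂ) ≠ 0 := by exact_mod_cast hm.ne'
  have hm'' : ((m + 1 : ℕ) : ℂ) ≠ 0 := by exact_mod_cast m.succ_ne_zero
  have h1 : 1 - s ≠ 0 := sub_ne_zero.2 hs.symm
  unfold zetaTerm
  refine DifferentiableAt.sub ?_ (DifferentiableAt.div (DifferentiableAt.sub ?_ ?_) (by fun_prop) h1)
  · exact DifferentiableAt.const_cpow (by fun_prop) (Or.inl hm')
  · exact DifferentiableAt.const_cpow (by fun_prop) (Or.inl hm'')
  · exact DifferentiableAt.const_cpow (by fun_prop) (Or.inl hm')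

theorem norm_deriv_zetaTerm_le {m : ℕ} (hm : 0 < m) {s : ℂ} (hs : 1 ≤ s.re) (ht : 1 ≤ |s.im|) :
    ‖deriv (zetaTerm m) s‖ ≤
      40 * (‖s‖ + 1) ^ (1 / 10 : ℝ) * (m : ℝ) ^ (-(21 / 20) : ℝ) := by
  have hball : ∀ w ∈ Metric.closedBall s (1 / 20), 19 / 20 ≤ w.re ∧ w ≠ 1 ∧ ‖w‖ ≤ ‖s‖ + 1 := by
    intro w hw
    rw [mem_closedBall_iff_norm] at hw
    have hre := (Complex.abs_re_le_norm (w - s)).trans hw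
    have him := (Complex.abs_im_le_norm (w - s)).trans hw
    rw [Complex.sub_re, abs_le] at hre
    rw [Complex.sub_im] at him
    refine ⟨by linarith, ?_, ?_⟩
    · rintro rfl
      simp at him
      linarith
    · have := norm_sub_norm_le w s
      linarith
  have := Complex.norm_deriv_le_of_forall_mem_sphere_norm_le (c := s) (R := 1 / 20)
    (C := 2 * (‖s‖ + 1) ^ (1 / 10 : ℝ) * (m : ℝ) ^ (-(21 / 20) : ℝ)) (f := zetaTerm m)
    (by norm_num) ?_ ?_
  · refine this.trans (le_of_eq ?_)
    ring
  · refine DifferentiableOn.diffContOnCl ?_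
    refine DifferentiableOn.mono (t := Metric.closedBall s (1 / 20)) ?_ Metric.closure_ball_subset_closedBall
    exact fun w hw => (differentiableAt_zetaTerm hm (hball w hw).2.1).differentiableWithinAt
  · intro w hw
    obtain ⟨h1, h2, h3⟩ := hball w (Metric.sphere_subset_closedBall hw)
    have hm1 : (1 : ℝ) ≤ m := by exact_mod_cast hm
    refine (norm_zetaTerm_le hm (by linarith) h2 (θ := 1 / 10) (by norm_num) (by norm_num)).trans ?_
    gcongr 2 * ?_ * ?_
    · exact Real.rpow_le_rpow (norm_nonneg _) h3 (by norm_num)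
    · exact Real.rpow_le_rpow_of_exponent_le hm1 (by linarith)

theorem norm_one_add_le (x t : ℝ) (hx : 0 ≤ x) (hx1 : x ≤ 1) :
    ‖(1 : ℂ) + x + Complex.I * t‖ ≤ 2 + |t| := by
  refine (norm_add_le _ _).trans ?_
  gcongr
  · refine (norm_add_le _ _).trans ?_
    rw [norm_one, Complex.norm_real, Real.norm_eq_abs, abs_of_nonneg hx]
    linarith
  · simp

theorem norm_zetaTerm_sub_le {m : ℕ} (hm : 0 < m) {x y t : ℝ} (hx : 0 ≤ x) (hx1 : x ≤ 1)
    (hy : 0 ≤ y) (hy1 : y ≤ 1) (ht : 1 ≤ |t|) :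
    ‖zetaTerm m (1 + x + Complex.I * t) - zetaTerm m (1 + y + Complex.I * t)‖ ≤
      160 * |t| ^ (1 / 10 : ℝ) * |x - y| * (m : ℝ) ^ (-(21 / 20) : ℝ) := by
  have key := (convex_Icc (0 : ℝ) 1).norm_image_sub_le_of_norm_hasDerivWithin_le
    (f := fun v : ℝ => zetaTerm m (1 + v + Complex.I * t))
    (f' := fun v : ℝ => deriv (zetaTerm m) (1 + v + Complex.I * t))
    (C := 160 * |t| ^ (1 / 10 : ℝ) * (m : ℝ) ^ (-(21 / 20) : ℝ)) (x := y) (y := x) ?_ ?_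
    ⟨hy, hy1⟩ ⟨hx, hx1⟩
  · refine key.trans (le_of_eq ?_)
    rw [Real.norm_eq_abs]
    ring
  · intro v hv
    refine HasDerivAt.hasDerivWithinAt ?_
    have hne : (1 : ℂ) + v + Complex.I * t ≠ 1 := by
      intro h
      have := congrArg Complex.im h
      simp at this
      rw [this] at ht
      norm_num at ht
    have h1 := (differentiableAt_zetaTerm hm hne).hasDerivAt
    have h2 : HasDerivAt (fun v : ℂ => 1 + v + Complex.I * t) 1 (v : ℂ) :=
      ((hasDerivAt_id _).const_add 1).add_const _
    simpa using (h1.comp (v : ℂ) h2).comp_ofReal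
  · intro v hv
    refine (norm_deriv_zetaTerm_le hm (by simp [hv.1]) (by simpa using ht)).trans ?_
    have h3 := norm_one_add_le v t hv.1 hv.2
    have h4 : (‖(1 : ℂ) + v + Complex.I * t‖ + 1) ^ (1 / 10 : ℝ) ≤ 4 * |t| ^ (1 / 10 : ℝ) := by
      calc _ ≤ (4 * |t|) ^ (1 / 10 : ℝ) := by
            refine Real.rpow_le_rpow (by positivity) (by linarith) (by norm_num)
        _ = 4 ^ (1 / 10 : ℝ) * |t| ^ (1 / 10 : ℝ) := Real.mul_rpow (by norm_num) (by positivity)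
        _ ≤ _ := by
          gcongr
          exact Real.rpow_le_self_of_one_le (by norm_num) (by norm_num)
    calc _ ≤ 40 * (4 * |t| ^ (1 / 10 : ℝ)) * (m : ℝ) ^ (-(21 / 20) : ℝ) := by gcongr
      _ = _ := by ring

theorem exists_riemannZeta_bounds : ∃ K : ℝ, 1 ≤ K ∧
    (∀ x : ℝ, 0 < x → x ≤ 1 → ‖riemannZeta (1 + x)‖ ≤ K / x) ∧
    (∀ x t : ℝ, 0 < x → x ≤ 1 → 1 ≤ |t| →
      ‖riemannZeta (1 + x + Complex.I * t)‖ ≤ K * |t| ^ (1 / 10 : ℝ)) ∧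
    (∀ x y t : ℝ, 0 < x → x ≤ 1 → 0 < y → y ≤ 1 → 1 ≤ |t| →
      ‖riemannZeta (1 + x + Complex.I * t) - riemannZeta (1 + y + Complex.I * t)‖ ≤
        K * |t| ^ (1 / 10 : ℝ) * |x - y|) := by
  have hS := summable_succ_rpow_neg (p := 21 / 20) (by norm_num)
  set S : ℝ := ∑' n : ℕ, ((n + 1 : ℕ) : ℝ) ^ (-(21 / 20) : ℝ) with hSdef
  have hS0 : 0 ≤ S := tsum_nonneg fun n => by positivity
  have hre : ∀ x t : ℝ, ((1 : ℂ) + x + Complex.I * t).re = 1 + x := by intro x t; simp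
  have hbound : ∀ x t : ℝ, 0 < x → x ≤ 1 →
      ‖riemannZeta (1 + x + Complex.I * t) - 1 / (1 + x + Complex.I * t - 1)‖ ≤
        2 * (2 + |t|) ^ (1 / 10 : ℝ) * S := by
    intro x t hx hx1
    set s := (1 : ℂ) + x + Complex.I * t with hs
    have hs1 : 1 < s.re := by rw [hre]; linarith
    have hne : s ≠ 1 := by intro h; rw [h] at hs1; simp at hs1
    rw [← (hasSum_zetaTerm hs1).tsum_eq]
    refine tsum_of_norm_bounded (hS.hasSum.mul_left _) fun n => ?_
    have h1n : (1 : ℝ) ≤ ((n + 1 : ℕ) : ℝ) := by push_cast; linarith [n.cast_nonneg (α := ℝ)]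
    refine (norm_zetaTerm_le n.succ_pos (by linarith) hne (θ := 1 / 10)
      (by norm_num) (by norm_num)).trans ?_
    gcongr 2 * ?_ * ?_
    · exact Real.rpow_le_rpow (norm_nonneg _) (norm_one_add_le x t hx.le hx1) (by norm_num)
    · exact Real.rpow_le_rpow_of_exponent_le h1n (by linarith)
  have hsub : ∀ x t : ℝ, (1 : ℂ) + x + Complex.I * t - 1 = x + Complex.I * t := by
    intro x t; ring
  have hnt : ∀ x t : ℝ, |t| ≤ ‖(x : ℂ) + Complex.I * t‖ := by
    intro x t
    simpa using Complex.abs_im_le_norm ((x : ℂ) + Complex.I * t)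
  have hone : ∀ t : ℝ, 1 ≤ |t| → 1 ≤ |t| ^ (1 / 10 : ℝ) :=
    fun t ht => Real.one_le_rpow ht (by norm_num)
  refine ⟨1 + 160 * S, by linarith, ?_, ?_, ?_⟩
  · intro x hx hx1
    have h := hbound x 0 hx hx1
    rw [hsub] at h
    simp only [Complex.ofReal_zero, mul_zero, add_zero, abs_zero] at h
    have h2 : (2 : ℝ) ^ (1 / 10 : ℝ) ≤ 2 := Real.rpow_le_self_of_one_le (by norm_num) (by norm_num)
    have h3 : ‖(1 : ℂ) / x‖ = 1 / x := by
      rw [norm_div, norm_one, Complex.norm_real, Real.norm_eq_abs, abs_of_pos hx]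
    have h4 := norm_sub_norm_le (riemannZeta (1 + x)) (1 / (x : ℂ))
    rw [h3] at h4
    rw [le_div_iff₀ hx]
    have h5 : ‖riemannZeta (1 + x)‖ ≤ 1 / x + 4 * S := by nlinarith
    calc _ ≤ (1 / x + 4 * S) * x := by gcongr
      _ = 1 + 4 * S * x := by field_simp
      _ ≤ _ := by nlinarith
  · intro x t hx hx1 ht
    have h := hbound x t hx hx1
    rw [hsub] at h
    have h3 : ‖(1 : ℂ) / (x + Complex.I * t)‖ ≤ 1 := by
      rw [norm_div, norm_one]
      exact div_le_one_of_le₀ (ht.trans (hnt x t)) (norm_nonneg _)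
    have h4 := norm_sub_norm_le (riemannZeta (1 + x + Complex.I * t)) (1 / ((x : ℂ) + Complex.I * t))
    have h5 : (2 + |t|) ^ (1 / 10 : ℝ) ≤ 3 * |t| ^ (1 / 10 : ℝ) := by
      calc _ ≤ (3 * |t|) ^ (1 / 10 : ℝ) :=
            Real.rpow_le_rpow (by positivity) (by linarith) (by norm_num)
        _ = 3 ^ (1 / 10 : ℝ) * |t| ^ (1 / 10 : ℝ) := Real.mul_rpow (by norm_num) (by positivity)
        _ ≤ _ := by
          gcongr
          exact Real.rpow_le_self_of_one_le (by norm_num) (by norm_num)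
    have h6 := hone t ht
    have h7 : 2 * (2 + |t|) ^ (1 / 10 : ℝ) * S ≤ 2 * (3 * |t| ^ (1 / 10 : ℝ)) * S := by gcongr
    have h8 : 0 ≤ S * |t| ^ (1 / 10 : ℝ) := by positivity
    nlinarith
  · intro x y t hx hx1 hy hy1 ht
    have hx' := hasSum_zetaTerm (s := 1 + x + Complex.I * t) (by rw [hre]; linarith)
    have hy' := hasSum_zetaTerm (s := 1 + y + Complex.I * t) (by rw [hre]; linarith)
    have h := hx'.sub hy'
    have hb : ‖riemannZeta (1 + x + Complex.I * t) - 1 / (1 + x + Complex.I * t - 1) -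
        (riemannZeta (1 + y + Complex.I * t) - 1 / (1 + y + Complex.I * t - 1))‖ ≤
          160 * |t| ^ (1 / 10 : ℝ) * |x - y| * S := by
      rw [← h.tsum_eq]
      exact tsum_of_norm_bounded (hS.hasSum.mul_left _) fun n =>
        norm_zetaTerm_sub_le n.succ_pos hx.le hx1 hy.le hy1 ht
    rw [hsub, hsub] at hb
    have hnx : (x : ℂ) + Complex.I * t ≠ 0 := norm_pos_iff.1 (by linarith [hnt x t])
    have hny : (y : ℂ) + Complex.I * t ≠ 0 := norm_pos_iff.1 (by linarith [hnt y t])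
    have h3 : ‖(1 : ℂ) / (x + Complex.I * t) - 1 / (y + Complex.I * t)‖ ≤ |x - y| := by
      have : (1 : ℂ) / (x + Complex.I * t) - 1 / (y + Complex.I * t) =
          -((x - y : ℝ) : ℂ) / ((x + Complex.I * t) * (y + Complex.I * t)) := by
        push_cast
        field_simp
        ring
      rw [this, norm_div, norm_neg, Complex.norm_real, Real.norm_eq_abs, norm_mul]
      refine div_le_self (abs_nonneg _) ?_
      exact one_le_mul_of_one_le_of_one_le (ht.trans (hnt x t)) (ht.trans (hnt y t))
    have h4 : riemannZeta (1 + x + Complex.I * t) - riemannZeta (1 + y + Complex.I * t) =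
      (riemannZeta (1 + x + Complex.I * t) - 1 / (x + Complex.I * t) -
        (riemannZeta (1 + y + Complex.I * t) - 1 / (y + Complex.I * t))) +
      ((1 : ℂ) / (x + Complex.I * t) - 1 / (y + Complex.I * t)) := by ring
    rw [h4]
    refine (norm_add_le _ _).trans ?_
    have h6 := hone t ht
    have h8 : |x - y| ≤ |t| ^ (1 / 10 : ℝ) * |x - y| := le_mul_of_one_le_left (abs_nonneg _) h6
    linarith

theorem one_div_le_of_lipschitz_of_cube_le {p : ℝ → ℝ} {K U : ℝ} (hK : 1 ≤ K) (hU : 1 ≤ U)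
    (hp : ∀ x, 0 ≤ p x)
    (hcube : ∀ x, 0 < x → x ≤ 1 → x ^ 3 ≤ K * U * p x ^ 4)
    (hlip : ∀ x y, 0 < x → x ≤ 1 → 0 < y → y ≤ 1 → |p x - p y| ≤ U * |x - y|)
    {σ : ℝ} (hσ : 0 < σ) (hσ1 : σ ≤ 1) : 1 / (16 * K * U ^ 4) ≤ p σ := by
  set x := 1 / (16 * K * U ^ 5) with hx
  have hx0 : 0 < x := by positivity
  have hx1 : x ≤ 1 := by
    rw [hx, div_le_one (by positivity)]
    have := one_le_pow₀ (n := 5) hU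
    nlinarith
  have hxU : x * U = 1 / (16 * K * U ^ 4) := by rw [hx]; field_simp
  have hlow : ∀ y, x ≤ y → y ≤ 1 → 2 * (x * U) ≤ p y := by
    intro y hy hy1
    have h1 : x ^ 3 ≤ K * U * p y ^ 4 :=
      (pow_le_pow_left₀ hx0.le hy 3).trans (hcube y (hx0.trans_le hy) hy1)
    refine le_of_pow_le_pow_left₀ (n := 4) (by norm_num) (hp y) ?_
    have h2 : K * U * (2 * (x * U)) ^ 4 = x ^ 3 := by
      calc _ = x ^ 3 * (16 * K * U ^ 5 * x) := by ring
        _ = x ^ 3 * 1 := by rw [hx]; field_simp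
        _ = x ^ 3 := mul_one _
    rw [← h2] at h1
    exact le_of_mul_le_mul_left h1 (by positivity)
  rw [← hxU]
  have hpos : 0 < x * U := by positivity
  rcases le_total x σ with h | h
  · linarith [hlow σ h hσ1]
  · have h1 := hlow x le_rfl hx1
    have h2 := hlip x σ hx0 hx1 hσ hσ1
    rw [abs_of_nonneg (by linarith : 0 ≤ x - σ)] at h2
    have h3 := (le_abs_self _).trans h2
    nlinarith

theorem norm_riemannZeta_product_ge_one {x : ℝ} (hx : 0 < x) (t : ℝ) :
    1 ≤ ‖riemannZeta (1 + x)‖ ^ 3 * ‖riemannZeta (1 + x + Complex.I * t)‖ ^ 4 *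
      ‖riemannZeta (1 + x + Complex.I * (2 * t : ℝ))‖ := by
  have := DirichletCharacter.norm_LFunction_product_ge_one (1 : DirichletCharacter ℂ 1) hx t
  simp only [DirichletCharacter.LFunctionTrivChar, DirichletCharacter.LFunction_modOne_eq,
    norm_mul, norm_pow] at this
  have e : (1 : ℂ) + x + Complex.I * (2 * t : ℝ) = 1 + x + 2 * Complex.I * t := by
    push_cast
    ring
  rwa [e]

theorem exists_norm_riemannZeta_ge : ∃ c : ℝ, 0 < c ∧ ∀ x t : ℝ, 0 < x → x ≤ 1 → 1 ≤ |t| →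
    c ≤ ‖riemannZeta (1 + x + Complex.I * t)‖ * |t| ^ (2 / 5 : ℝ) := by
  obtain ⟨K, hK, h1, h2, h3⟩ := exists_riemannZeta_bounds
  refine ⟨1 / (16 * K ^ 3 * (2 * K) ^ 4), by positivity, fun x t hx hx1 ht => ?_⟩
  have ht1 : 1 ≤ |t| ^ (1 / 10 : ℝ) := Real.one_le_rpow ht (by norm_num)
  have key := one_div_le_of_lipschitz_of_cube_le (K := K ^ 3) (U := 2 * K * |t| ^ (1 / 10 : ℝ))
    (p := fun v => ‖riemannZeta (1 + v + Complex.I * t)‖) (one_le_pow₀ hK)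
    (by nlinarith) (fun v => norm_nonneg _) ?_ ?_ hx hx1
  · have e : (|t| ^ (1 / 10 : ℝ)) ^ 4 = |t| ^ (2 / 5 : ℝ) := by
      rw [← Real.rpow_natCast, ← Real.rpow_mul (abs_nonneg _)]
      norm_num
    rw [mul_pow, e] at key
    rw [div_le_iff₀ (by positivity)] at key ⊢
    linarith
  · intro v hv hv1
    have hp := norm_riemannZeta_product_ge_one hv t
    have h4 := h1 v hv hv1
    have ht2 : 1 ≤ |2 * t| := by rw [abs_mul, abs_two]; linarith
    have h5 := h2 v (2 * t) hv hv1 ht2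
    have h6 : |2 * t| ^ (1 / 10 : ℝ) ≤ 2 * |t| ^ (1 / 10 : ℝ) := by
      rw [abs_mul, abs_two, Real.mul_rpow (by norm_num) (abs_nonneg _)]
      gcongr
      exact Real.rpow_le_self_of_one_le (by norm_num) (by norm_num)
    have h7 : ‖riemannZeta (1 + v + Complex.I * (2 * t : ℝ))‖ ≤ 2 * K * |t| ^ (1 / 10 : ℝ) := by
      refine h5.trans ?_
      calc _ ≤ K * (2 * |t| ^ (1 / 10 : ℝ)) := by gcongr
        _ = _ := by ring
    have h8 : 1 ≤ (K / v) ^ 3 * ‖riemannZeta (1 + v + Complex.I * t)‖ ^ 4 *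
        (2 * K * |t| ^ (1 / 10 : ℝ)) := by
      refine hp.trans ?_
      gcongr
    calc v ^ 3 = v ^ 3 * 1 := (mul_one _).symm
      _ ≤ v ^ 3 * ((K / v) ^ 3 * ‖riemannZeta (1 + v + Complex.I * t)‖ ^ 4 *
        (2 * K * |t| ^ (1 / 10 : ℝ))) := by gcongr
      _ = _ := by field_simp
  · intro v w hv hv1 hw hw1
    refine (abs_norm_sub_norm_le _ _).trans ((h3 v w t hv hv1 hw hw1 ht).trans ?_)
    gcongr
    linarith

theorem exists_norm_inv_riemannZeta₁_sq_le : ∃ K : ℝ, 0 < K ∧ ∀ x t : ℝ, 0 < x → x ≤ 1 →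
    ‖(riemannZeta₁ (1 + x + Complex.I * t))⁻¹‖ ^ 2 ≤ K * (1 + ‖t‖ ^ 2) ^ (-(6 / 5 : ℝ) / 2) := by
  obtain ⟨c, hc, hlow⟩ := exists_norm_riemannZeta_ge
  have hne : ∀ x t : ℝ, 0 ≤ x → riemannZeta₁ (1 + x + Complex.I * t) ≠ 0 := by
    intro x t hx h0
    by_cases h1 : (1 : ℂ) + x + Complex.I * t = 1
    · rw [h1, riemannZeta₁_one] at h0
      exact one_ne_zero h0
    · have := riemannZeta_eq_inv_sub_mul h1
      rw [h0, mul_zero] at this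
      exact riemannZeta_ne_zero_of_one_le_re (by simpa using hx) this
  obtain ⟨B, hB⟩ : ∃ B : ℝ, ∀ q ∈ Set.Icc (0 : ℝ) 1 ×ˢ Set.Icc (-1 : ℝ) 1,
      ‖(riemannZeta₁ (1 + q.1 + Complex.I * q.2))⁻¹‖ ≤ B := by
    refine (isCompact_Icc.prod isCompact_Icc).exists_bound_of_continuousOn ?_
    refine ContinuousOn.inv₀ ?_ fun q hq => hne _ _ hq.1.1
    have := differentiable_riemannZeta₁.continuous
    fun_prop
  refine ⟨2 * (1 + B ^ 2 + 1 / c ^ 2), by positivity, fun x t hx hx1 => ?_⟩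
  have hbase : 0 < 1 + ‖t‖ ^ 2 := by positivity
  rcases le_total |t| 1 with ht | ht
  · have h1 := hB (x, t) ⟨⟨hx.le, hx1⟩, abs_le.1 ht⟩
    have h2 : ‖(riemannZeta₁ (1 + x + Complex.I * t))⁻¹‖ ^ 2 ≤ B ^ 2 :=
      pow_le_pow_left₀ (norm_nonneg _) h1 2
    have h3 : (1 : ℝ) / 2 ≤ (1 + ‖t‖ ^ 2) ^ (-(6 / 5 : ℝ) / 2) := by
      have h4 : 1 + ‖t‖ ^ 2 ≤ 2 := by
        rw [Real.norm_eq_abs]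
        have := pow_le_one₀ (n := 2) (abs_nonneg t) ht
        linarith
      calc (1 : ℝ) / 2 = 2 ^ (-1 : ℝ) := by rw [Real.rpow_neg_one]; norm_num
        _ ≤ 2 ^ (-(6 / 5 : ℝ) / 2) :=
          Real.rpow_le_rpow_of_exponent_le (by norm_num) (by norm_num)
        _ ≤ _ := Real.rpow_le_rpow_of_nonpos hbase h4 (by norm_num)
    have h5 : 0 ≤ 1 / c ^ 2 := by positivity
    nlinarith [sq_nonneg B]
  · have hs1 : (1 : ℂ) + x + Complex.I * t ≠ 1 := by
      intro h
      have := congrArg Complex.im h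
      simp at this
      rw [this] at ht
      norm_num at ht
    have hsub : (1 : ℂ) + x + Complex.I * t - 1 = x + Complex.I * t := by ring
    have hnt : |t| ≤ ‖(x : ℂ) + Complex.I * t‖ := by
      simpa using Complex.abs_im_le_norm ((x : ℂ) + Complex.I * t)
    have ht0 : 0 < |t| := by linarith
    have hz : riemannZeta₁ (1 + x + Complex.I * t) =
        (x + Complex.I * t) * riemannZeta (1 + x + Complex.I * t) := by
      have h0 : (x : ℂ) + Complex.I * t ≠ 0 := norm_pos_iff.1 (by linarith)
      rw [riemannZeta_eq_inv_sub_mul hs1, hsub]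
      field_simp
    have hl := hlow x t hx hx1 ht
    have h1 : c * |t| ^ (3 / 5 : ℝ) ≤ ‖riemannZeta₁ (1 + x + Complex.I * t)‖ := by
      rw [hz, norm_mul]
      calc c * |t| ^ (3 / 5 : ℝ) ≤ (‖riemannZeta (1 + x + Complex.I * t)‖ * |t| ^ (2 / 5 : ℝ)) *
            |t| ^ (3 / 5 : ℝ) := by gcongr
        _ = |t| * ‖riemannZeta (1 + x + Complex.I * t)‖ := by
          rw [mul_assoc, ← Real.rpow_add ht0, mul_comm]
          norm_num
        _ ≤ _ := by gcongr
    have h2 : ‖(riemannZeta₁ (1 + x + Complex.I * t))⁻¹‖ ^ 2 ≤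
        1 / c ^ 2 * (|t| ^ 2) ^ (-(6 / 5 : ℝ) / 2) := by
      have e : (|t| ^ 2) ^ (-(6 / 5 : ℝ) / 2) = ((|t| ^ (3 / 5 : ℝ)) ^ 2)⁻¹ := by
        rw [← Real.rpow_natCast, ← Real.rpow_natCast, ← Real.rpow_mul ht0.le,
          ← Real.rpow_mul ht0.le, ← Real.rpow_neg ht0.le]
        norm_num
      rw [e, norm_inv, inv_pow, one_div, ← mul_inv, ← mul_pow]
      gcongr
    refine h2.trans ?_
    have h3 : (|t| ^ 2) ^ (-(6 / 5 : ℝ) / 2) ≤ 2 * (1 + ‖t‖ ^ 2) ^ (-(6 / 5 : ℝ) / 2) := by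
      have h4 : 1 + ‖t‖ ^ 2 ≤ 2 * |t| ^ 2 := by
        rw [Real.norm_eq_abs]
        have := one_le_pow₀ (n := 2) ht
        linarith
      have h5 : (2 * |t| ^ 2) ^ (-(6 / 5 : ℝ) / 2) ≤ (1 + ‖t‖ ^ 2) ^ (-(6 / 5 : ℝ) / 2) :=
        Real.rpow_le_rpow_of_nonpos hbase h4 (by norm_num)
      rw [Real.mul_rpow (by norm_num) (by positivity)] at h5
      have h6 : (1 : ℝ) / 2 ≤ 2 ^ (-(6 / 5 : ℝ) / 2) := by
        calc (1 : ℝ) / 2 = 2 ^ (-1 : ℝ) := by rw [Real.rpow_neg_one]; norm_num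
          _ ≤ _ := Real.rpow_le_rpow_of_exponent_le (by norm_num) (by norm_num)
      have h7 : 0 ≤ (|t| ^ 2) ^ (-(6 / 5 : ℝ) / 2) := by positivity
      nlinarith
    have h8 : 0 ≤ (1 + ‖t‖ ^ 2) ^ (-(6 / 5 : ℝ) / 2) := by positivity
    calc _ ≤ 1 / c ^ 2 * (2 * (1 + ‖t‖ ^ 2) ^ (-(6 / 5 : ℝ) / 2)) := by gcongr
      _ = 2 * (1 / c ^ 2) * (1 + ‖t‖ ^ 2) ^ (-(6 / 5 : ℝ) / 2) := by ring
      _ ≤ _ := by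
        gcongr
        nlinarith [sq_nonneg B]

open scoped FourierTransform SchwartzMap ENNReal in
theorem fourier_toLp_eq {f : ℝ → ℂ} (h1 : Integrable f) (h2 : MemLp f 2) (hF : MemLp (𝓕 f) 2) :
    𝓕 (h2.toLp f) = hF.toLp (𝓕 f) := by
  have hinj := (LinearMap.ker_eq_bot.1
    (Lp.ker_toTemperedDistributionCLM_eq_bot (F := ℂ) (E := ℝ) (μ := volume) (p := 2)))
  apply hinj
  change ((𝓕 (h2.toLp f) : Lp ℂ 2 (volume : Measure ℝ)) : 𝓢'(ℝ, ℂ)) =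
    ((hF.toLp (𝓕 f) : Lp ℂ 2 (volume : Measure ℝ)) : 𝓢'(ℝ, ℂ))
  rw [← Lp.fourier_toTemperedDistribution_eq]
  ext g
  rw [TemperedDistribution.fourier_apply, Lp.toTemperedDistribution_apply,
    Lp.toTemperedDistribution_apply]
  have e1 : ∫ x, (𝓕 g) x • (h2.toLp f) x = ∫ x, (𝓕 g) x • f x := by
    refine integral_congr_ae ?_
    filter_upwards [h2.coeFn_toLp] with x hx
    rw [hx]
  have e2 : ∫ x, g x • (hF.toLp (𝓕 f)) x = ∫ x, g x • 𝓕 f x := by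
    refine integral_congr_ae ?_
    filter_upwards [hF.coeFn_toLp] with x hx
    rw [hx]
  rw [e1, e2, SchwartzMap.fourier_coe]
  simpa using! (VectorFourier.integral_fourierIntegral_smul_eq_flip (L := innerₗ ℝ)
    (μ := volume) (ν := volume) Real.continuous_fourierChar continuous_inner g.integrable h1)

open scoped FourierTransform in
/-- Plancherel's identity for integrable, square integrable functions. -/
theorem integral_norm_sq_fourier_eq {f : ℝ → ℂ} (h1 : Integrable f) (h2 : MemLp f 2)
    (hF : MemLp (𝓕 f) 2) : ∫ x, ‖𝓕 f x‖ ^ 2 = ∫ x, ‖f x‖ ^ 2 := by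
  have key : ‖hF.toLp (𝓕 f)‖ = ‖h2.toLp f‖ := by
    rw [← fourier_toLp_eq h1 h2 hF, Lp.norm_fourier_eq]
  have hL : ∀ {g : ℝ → ℂ} (hg : MemLp g 2), ‖hg.toLp g‖ ^ 2 = ∫ x, ‖g x‖ ^ 2 := by
    intro g hg
    rw [Lp.norm_toLp, toReal_eLpNorm hg.1,
      lpNorm_eq_integral_norm_rpow_toReal (by norm_num) (by norm_num) hg.1]
    have h0 : 0 ≤ ∫ x, ‖g x‖ ^ 2 := integral_nonneg fun x => by positivity
    simp only [ENNReal.toReal_ofNat, Real.rpow_ofNat]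
    rw [← Real.rpow_natCast, ← Real.rpow_mul h0]
    norm_num
  rw [← hL hF, ← hL h2, key]

theorem LSeries_moebius_div_eq {s : ℂ} (hs : 0 < s.re) :
    LSeriesSummable (fun n => (ArithmeticFunction.moebius n : ℂ) / n) s ∧
    LSeries (fun n => (ArithmeticFunction.moebius n : ℂ) / n) s = (riemannZeta (1 + s))⁻¹ := by
  have hs' : 1 < (1 + s).re := by simpa using hs
  have hterm : LSeries.term (fun n => (ArithmeticFunction.moebius n : ℂ) / n) s =
      LSeries.term (fun n => (ArithmeticFunction.moebius n : ℂ)) (1 + s) := by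
    funext n
    rcases eq_or_ne n 0 with rfl | hn
    · simp
    · have hn' : (n : ℂ) ≠ 0 := by exact_mod_cast hn
      rw [LSeries.term_of_ne_zero hn, LSeries.term_of_ne_zero hn, Complex.cpow_add _ _ hn',
        Complex.cpow_one, div_div]
  constructor
  · rw [LSeriesSummable, hterm]
    exact ArithmeticFunction.LSeriesSummable_moebius_iff.2 hs'
  · rw [LSeries, hterm]
    have h := LSeries_one_mul_Lseries_moebius hs'
    rw [LSeries_one_eq_riemannZeta hs'] at h
    exact eq_inv_of_mul_eq_one_right h

theorem sum_Icc_moebius_div (n : ℕ) :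
    ∑ k ∈ Icc 1 n, (ArithmeticFunction.moebius k : ℂ) / k = (mobG n : ℂ) := by
  rw [mobG]
  push_cast
  rfl

theorem mellin_mobG {s : ℂ} (hs : 0 < s.re) :
    mellin (fun t => (mobG ⌊t⌋₊ : ℂ)) (-s) = (riemannZeta₁ (1 + s))⁻¹ := by
  have hs0 : s ≠ 0 := by rintro rfl; simp at hs
  obtain ⟨hsum, hval⟩ := LSeries_moebius_div_eq hs
  have hO : (fun n : ℕ => ∑ k ∈ Icc 1 n, (ArithmeticFunction.moebius k : ℂ) / k) =O[atTop]
      fun n : ℕ => (n : ℝ) ^ (0 : ℝ) := by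
    refine Asymptotics.IsBigO.of_bound 1 (Eventually.of_forall fun n => ?_)
    rw [sum_Icc_moebius_div, Complex.norm_real]
    simpa using abs_mobG_le_one n
  have h := LSeries_eq_mul_integral _ le_rfl hs hsum hO
  have hmel : mellin (fun t => (mobG ⌊t⌋₊ : ℂ)) (-s) =
      ∫ t in Set.Ioi (1 : ℝ), (∑ k ∈ Icc 1 ⌊t⌋₊, (ArithmeticFunction.moebius k : ℂ) / k) *
        t ^ (-(s + 1)) := by
    rw [mellin, ← integral_indicator measurableSet_Ioi, ← integral_indicator measurableSet_Ioi]
    have hne : ∀ᵐ t : ℝ, t ≠ 1 := by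
      simp [ae_iff]
    refine integral_congr_ae ?_
    filter_upwards [hne] with t ht
    simp only [sum_Icc_moebius_div]
    by_cases h1 : 1 < t
    · rw [Set.indicator_of_mem (Set.mem_Ioi.2 (zero_lt_one.trans h1)),
        Set.indicator_of_mem (Set.mem_Ioi.2 h1), smul_eq_mul, mul_comm]
      ring_nf
    · have hlt : t < 1 := lt_of_le_of_ne (not_lt.1 h1) ht
      rw [Set.indicator_of_notMem (s := Set.Ioi 1) (by simpa using h1)]
      simp [Nat.floor_eq_zero.2 hlt, mobG]
  rw [hmel]
  rw [hval] at h
  have hne : 1 + s ≠ 1 := by simpa using hs0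
  rw [riemannZeta_eq_inv_sub_mul hne, add_sub_cancel_left, mul_inv, inv_inv] at h
  exact (mul_left_cancel₀ hs0 h).symm

open scoped FourierTransform in
theorem fourier_exp_mul_mobG {σ : ℝ} (hσ : 0 < σ) (ξ : ℝ) :
    𝓕 (fun u : ℝ => ((Real.exp (σ * u) * mobG ⌊Real.exp (-u)⌋₊ : ℝ) : ℂ)) ξ =
      (riemannZeta₁ (1 + σ + Complex.I * ((-(2 * Real.pi * ξ) : ℝ) : ℂ)))⁻¹ := by
  have h := mellin_mobG (s := (σ : ℂ) + Complex.I * ((-(2 * Real.pi * ξ) : ℝ) : ℂ)) (by simpa using hσ)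
  rw [mellin_eq_fourier, ← add_assoc] at h
  rw [← h]
  congr! 2
  · simp
  · simp only [Complex.neg_im, Complex.add_im, Complex.ofReal_im, Complex.mul_im, Complex.I_re,
      Complex.I_im, Complex.ofReal_re]
    field_simp
    ring

theorem integrable_exp_mul_mobG {σ : ℝ} (hσ : 0 < σ) :
    Integrable (fun u : ℝ => ((Real.exp (σ * u) * mobG ⌊Real.exp (-u)⌋₊ : ℝ) : ℂ)) ∧
    MemLp (fun u : ℝ => ((Real.exp (σ * u) * mobG ⌊Real.exp (-u)⌋₊ : ℝ) : ℂ)) 2 := by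
  set f := fun u : ℝ => ((Real.exp (σ * u) * mobG ⌊Real.exp (-u)⌋₊ : ℝ) : ℂ) with hf
  have hmeas : Measurable f := by
    refine Complex.measurable_ofReal.comp (Measurable.mul (by fun_prop) ?_)
    simpa using measurable_mobG_floor_exp (-1)
  have hzero : ∀ u, 0 < u → f u = 0 := by
    intro u hu
    have : Real.exp (-u) < 1 := by rw [Real.exp_lt_one_iff]; linarith
    simp [hf, Nat.floor_eq_zero.2 this, mobG]
  have hle : ∀ u, ‖f u‖ ≤ Real.exp (σ * u) := by
    intro u
    rw [hf, Complex.norm_real, Real.norm_eq_abs, abs_mul, Real.abs_exp]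
    exact mul_le_of_le_one_right (Real.exp_pos _).le (abs_mobG_le_one _)
  have hint : Integrable f := by
    have h0 : Integrable ((Set.Iic (0 : ℝ)).indicator fun u => Real.exp (σ * u)) :=
      (integrable_indicator_iff measurableSet_Iic).2 (integrableOn_exp_mul_Iic hσ 0)
    refine h0.mono' hmeas.aestronglyMeasurable (Eventually.of_forall fun u => ?_)
    by_cases hu : u ≤ 0
    · rw [Set.indicator_of_mem (Set.mem_Iic.2 hu)]
      exact hle u
    · rw [Set.indicator_of_notMem (by simpa using hu), hzero u (not_le.1 hu), norm_zero]
  refine ⟨hint, (memLp_two_iff_integrable_sq_norm hmeas.aestronglyMeasurable).2 ?_⟩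
  refine hint.norm.mono' (hmeas.norm.pow_const 2).aestronglyMeasurable
    (Eventually.of_forall fun u => ?_)
  have h1 : ‖f u‖ ≤ 1 := by
    by_cases hu : u ≤ 0
    · refine (hle u).trans (Real.exp_le_one_iff.2 ?_)
      exact mul_nonpos_of_nonneg_of_nonpos hσ.le hu
    · rw [hzero u (not_le.1 hu), norm_zero]
      exact zero_le_one
  rw [norm_pow, norm_norm, sq]
  exact mul_le_of_le_one_left (norm_nonneg _) h1

open scoped FourierTransform in
theorem exists_integral_exp_mul_mobG_sq_le : ∃ K : ℝ, 0 ≤ K ∧ ∀ σ : ℝ, 0 < σ → σ ≤ 1 →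
    Integrable (fun u : ℝ => (Real.exp (σ * u) * mobG ⌊Real.exp (-u)⌋₊) ^ 2) ∧
    ∫ u : ℝ, (Real.exp (σ * u) * mobG ⌊Real.exp (-u)⌋₊) ^ 2 ≤ K := by
  obtain ⟨K, hK, hbound⟩ := exists_norm_inv_riemannZeta₁_sq_le
  have hdom : Integrable fun ξ : ℝ => K * (1 + ‖ξ‖ ^ 2) ^ (-(6 / 5 : ℝ) / 2) :=
    (integrable_rpow_neg_one_add_norm_sq (by norm_num)).const_mul K
  refine ⟨∫ ξ : ℝ, K * (1 + ‖ξ‖ ^ 2) ^ (-(6 / 5 : ℝ) / 2),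
    integral_nonneg fun ξ => by positivity, fun σ hσ hσ1 => ?_⟩
  obtain ⟨h1, h2⟩ := integrable_exp_mul_mobG hσ
  set f := fun u : ℝ => ((Real.exp (σ * u) * mobG ⌊Real.exp (-u)⌋₊ : ℝ) : ℂ) with hf
  have hFle : ∀ ξ, ‖𝓕 f ξ‖ ^ 2 ≤ K * (1 + ‖ξ‖ ^ 2) ^ (-(6 / 5 : ℝ) / 2) := by
    intro ξ
    rw [hf, fourier_exp_mul_mobG hσ]
    refine (hbound σ _ hσ hσ1).trans ?_
    gcongr ?_ * ?_
    refine Real.rpow_le_rpow_of_nonpos (by positivity) ?_ (by norm_num)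
    gcongr
    rw [norm_neg, norm_mul]
    refine le_mul_of_one_le_left (norm_nonneg _) ?_
    rw [Real.norm_eq_abs]
    refine le_trans ?_ (le_abs_self _)
    linarith [Real.pi_gt_three]
  have hFcont : Continuous (𝓕 f) :=
    VectorFourier.fourierIntegral_continuous Real.continuous_fourierChar
      (L := innerₗ ℝ) continuous_inner h1
  have hFint : Integrable fun ξ => ‖𝓕 f ξ‖ ^ 2 := by
    refine hdom.mono' (hFcont.norm.pow 2).aestronglyMeasurable (Eventually.of_forall fun ξ => ?_)
    rw [norm_pow, norm_norm]
    exact hFle ξ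
  have hF : MemLp (𝓕 f) 2 :=
    (memLp_two_iff_integrable_sq_norm hFcont.aestronglyMeasurable).2 hFint
  have hsq : (fun u : ℝ => (Real.exp (σ * u) * mobG ⌊Real.exp (-u)⌋₊) ^ 2) = fun u => ‖f u‖ ^ 2 := by
    funext u
    rw [hf, Complex.norm_real, Real.norm_eq_abs, sq_abs]
  rw [hsq]
  refine ⟨(memLp_two_iff_integrable_sq_norm h2.1).1 h2, ?_⟩
  rw [← integral_norm_sq_fourier_eq h1 h2 hF]
  exact integral_mono hFint hdom hFle

theorem exists_integral_mobG_floor_exp_sq_le : ∃ K : ℝ, 0 ≤ K ∧ ∀ N : ℕ, 0 < N →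
    ∫ v in Real.log ((N : ℝ) / (N + 1))..Real.log N, mobG ⌊Real.exp v⌋₊ ^ 2 ≤ K := by
  obtain ⟨K, hK, hbound⟩ := exists_integral_exp_mul_mobG_sq_le
  refine ⟨Real.exp 2 * K, by positivity, fun N hN => ?_⟩
  have hN1 : (1 : ℝ) ≤ N := by exact_mod_cast hN
  set a := Real.log ((N : ℝ) / (N + 1)) with ha
  set b := Real.log N with hb
  have hb0 : 0 ≤ b := Real.log_nonneg hN1
  have hab : a ≤ b := by
    refine Real.log_le_log (by positivity) ?_
    exact div_le_self (by positivity) (by linarith)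
  set σ := 1 / (1 + b) with hσ
  have hσ0 : 0 < σ := by positivity
  have hσ1 : σ ≤ 1 := by
    rw [hσ, div_le_one (by positivity)]
    linarith
  obtain ⟨hint, hle⟩ := hbound σ hσ0 hσ1
  set G := fun u : ℝ => (Real.exp (σ * u) * mobG ⌊Real.exp (-u)⌋₊) ^ 2 with hG
  have hpt : ∀ v ∈ Set.Icc a b, mobG ⌊Real.exp v⌋₊ ^ 2 ≤ Real.exp 2 * G (-v) := by
    intro v hv
    have h1 : 1 ≤ Real.exp 2 * Real.exp (σ * -v) ^ 2 := by
      rw [← Real.exp_nat_mul, ← Real.exp_add, Real.one_le_exp_iff]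
      have : σ * v ≤ 1 := by
        rw [hσ, div_mul_eq_mul_div, div_le_one (by positivity)]
        linarith [hv.2]
      push_cast
      linarith
    simp only [hG, mul_pow, neg_neg, ← mul_assoc]
    exact le_mul_of_one_le_left (sq_nonneg _) h1
  have hint' : Integrable fun v => Real.exp 2 * G (-v) := hint.comp_neg.const_mul _
  have hmeas : Measurable fun v : ℝ => mobG ⌊Real.exp v⌋₊ ^ 2 := by
    simpa using (measurable_mobG_floor_exp 1).pow_const 2
  have hH : IntervalIntegrable (fun v : ℝ => mobG ⌊Real.exp v⌋₊ ^ 2) volume a b := by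
    refine (intervalIntegrable_const (c := (1 : ℝ))).mono_fun hmeas.aestronglyMeasurable
      (Eventually.of_forall fun v => ?_)
    simp only [norm_pow, Real.norm_eq_abs, norm_one]
    exact pow_le_one₀ (abs_nonneg _) (abs_mobG_le_one _)
  calc _ ≤ ∫ v in a..b, Real.exp 2 * G (-v) :=
        intervalIntegral.integral_mono_on hab hH hint'.intervalIntegrable hpt
    _ = ∫ v in Set.Ioc a b, Real.exp 2 * G (-v) := intervalIntegral.integral_of_le hab
    _ ≤ ∫ v, Real.exp 2 * G (-v) :=
        setIntegral_le_integral hint' (Eventually.of_forall fun v => by simp only [hG]; positivity)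
    _ = Real.exp 2 * ∫ u, G u := by rw [integral_const_mul, integral_neg_eq_self]
    _ ≤ _ := by gcongr

theorem stmt2 :
    ∃ C > (0 : ℝ), ∀ x z : ℝ, 1 ≤ x → 1 ≤ z → Ssum x z ≤ C * (x + z ^ 2) := by
  obtain ⟨K, hK, hbound⟩ := exists_integral_mobG_floor_exp_sq_le
  refine ⟨50 + 4 * K, by positivity, fun x z hx hz => ?_⟩
  have hN : 0 < ⌊z⌋₊ := Nat.floor_pos.2 hz
  have hS : Sz z ≤ 50 + 4 * K :=
    (Sz_le_sum_mobG z).trans ((sum_mobG_div_sq_le _ hN).trans (by linarith [hbound _ hN]))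
  have h := Ssum_le (x := x) (z := z) (by linarith) (by linarith)
  calc Ssum x z ≤ x * Sz z + z ^ 2 := h
    _ ≤ x * (50 + 4 * K) + (50 + 4 * K) * z ^ 2 := by
      gcongr
      exact le_mul_of_one_le_left (sq_nonneg z) (by linarith)
    _ = _ := by ring
end

section
/- There exists a constant C > 0 such that for all real x ≥ 1 and z ≥ 1, |S(x, z) − x·S(z)| ≤ C·z². -/
open Finset MeasureTheory Filter

lemma mobM_eq_sum_Icc (n : ℕ) (hn : n ≠ 0) (z : ℝ) (hz : 0 ≤ z) :
    (mobM n z : ℝ) =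
      ∑ d ∈ Finset.Icc 1 ⌊z⌋₊, if d ∣ n then (ArithmeticFunction.moebius d : ℝ) else 0 := by
  rw [mobM, Int.cast_sum, ← Finset.sum_filter]
  refine Finset.sum_congr ?_ fun _ _ => rfl
  ext d
  simp only [Finset.mem_filter, Nat.mem_divisors, Finset.mem_Icc, Nat.le_floor_iff hz]
  constructor
  · rintro ⟨⟨hd, _⟩, hdz⟩
    exact ⟨⟨Nat.pos_of_dvd_of_pos hd (Nat.pos_of_ne_zero hn), hdz⟩, hd⟩
  · rintro ⟨⟨_, hdz⟩, hd⟩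
    exact ⟨⟨hd, hn⟩, hdz⟩

lemma Ssum_eq_sum_floor (x z : ℝ) (hz : 0 ≤ z) :
    Ssum x z = ∑ m ∈ Finset.Icc 1 ⌊z⌋₊, ∑ n ∈ Finset.Icc 1 ⌊z⌋₊,
      ((ArithmeticFunction.moebius m : ℝ) * (ArithmeticFunction.moebius n : ℝ)) *
        (⌊x / (Nat.lcm m n : ℝ)⌋₊ : ℝ) := by
  have hsq : ∀ k ∈ Finset.Icc 1 ⌊x⌋₊, (mobM k z : ℝ) ^ 2 =
      ∑ m ∈ Finset.Icc 1 ⌊z⌋₊, ∑ n ∈ Finset.Icc 1 ⌊z⌋₊,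
        ((ArithmeticFunction.moebius m : ℝ) * (ArithmeticFunction.moebius n : ℝ)) *
          (if Nat.lcm m n ∣ k then 1 else 0) := by
    intro k hk
    rw [mobM_eq_sum_Icc k (by have := Finset.mem_Icc.mp hk; omega) z hz, sq, Finset.sum_mul_sum]
    refine Finset.sum_congr rfl fun m _ => Finset.sum_congr rfl fun n _ => ?_
    by_cases hm : m ∣ k <;> by_cases hn : n ∣ k <;> simp [Nat.lcm_dvd_iff, hm, hn]
  rw [Ssum, Finset.sum_congr rfl hsq, Finset.sum_comm]
  refine Finset.sum_congr rfl fun m _ => ?_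
  rw [Finset.sum_comm]
  refine Finset.sum_congr rfl fun n _ => ?_
  rw [← Finset.mul_sum, Finset.sum_boole, Nat.floor_div_natCast, ← Nat.Ioc_filter_dvd_card_eq_div]
  rfl

lemma abs_moebius_mul_floor_sub_le_one (m n : ℕ) {y : ℝ} (hy : 0 ≤ y) :
    |((ArithmeticFunction.moebius m : ℝ) * (ArithmeticFunction.moebius n : ℝ)) *
      ((⌊y⌋₊ : ℝ) - y)| ≤ 1 := by
  have hmu : ∀ k : ℕ, |(ArithmeticFunction.moebius k : ℝ)| ≤ 1 := fun k => by
    exact_mod_cast ArithmeticFunction.abs_moebius_le_one (n := k)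
  have hfl : |(⌊y⌋₊ : ℝ) - y| ≤ 1 := by
    rw [abs_le]
    constructor <;> linarith [Nat.floor_le hy, Nat.lt_floor_add_one y]
  rw [abs_mul, abs_mul]
  exact mul_le_one₀ (mul_le_one₀ (hmu m) (abs_nonneg _) (hmu n)) (abs_nonneg _) hfl

theorem stmt3 :
    ∃ C > (0 : ℝ), ∀ x z : ℝ, 1 ≤ x → 1 ≤ z → |Ssum x z - x * Sz z| ≤ C * z ^ 2 := by
  refine ⟨1, one_pos, fun x z hx hz => ?_⟩
  have hz0 : 0 ≤ z := by linarith
  have hdiff : Ssum x z - x * Sz z = ∑ m ∈ Finset.Icc 1 ⌊z⌋₊, ∑ n ∈ Finset.Icc 1 ⌊z⌋₊,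
      ((ArithmeticFunction.moebius m : ℝ) * (ArithmeticFunction.moebius n : ℝ)) *
        ((⌊x / (Nat.lcm m n : ℝ)⌋₊ : ℝ) - x / (Nat.lcm m n : ℝ)) := by
    rw [Ssum_eq_sum_floor x z hz0, Sz, Finset.mul_sum, ← Finset.sum_sub_distrib]
    refine Finset.sum_congr rfl fun m _ => ?_
    rw [Finset.mul_sum, ← Finset.sum_sub_distrib]
    exact Finset.sum_congr rfl fun n _ => by ring
  calc |Ssum x z - x * Sz z|
      ≤ ∑ _m ∈ Finset.Icc 1 ⌊z⌋₊, ∑ _n ∈ Finset.Icc 1 ⌊z⌋₊, (1 : ℝ) := by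
        rw [hdiff]
        refine (Finset.abs_sum_le_sum_abs _ _).trans (Finset.sum_le_sum fun m _ => ?_)
        refine (Finset.abs_sum_le_sum_abs _ _).trans (Finset.sum_le_sum fun n _ => ?_)
        exact abs_moebius_mul_floor_sub_le_one m n (by positivity)
    _ = (⌊z⌋₊ : ℝ) ^ 2 := by simp [sq]
    _ ≤ 1 * z ^ 2 := by
        rw [one_mul]
        exact pow_le_pow_left₀ (Nat.cast_nonneg _) (Nat.floor_le hz0) 2
end

section
/- For every integer m ≥ 1 and real y ≥ 1, one has the identity T(y; m) = (6/(π²ψ(m))) ∑_{δ ≤ y, gcd(δ, m) = 1} (δ·μ(δ)²/ψ(δ)²) (∑_{d ≤ y/δ} μ(dδ)/ψ_m(d))². -/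
open Finset MeasureTheory Filter

theorem psiM_pos (m n : ℕ) : 0 < psiM m n := Finset.prod_pos fun _ _ => Nat.succ_pos _

theorem psi_pos (n : ℕ) : 0 < psi n := Finset.prod_pos fun _ _ => Nat.succ_pos _

theorem primeFactors_lcm_eq_union {a b : ℕ} (ha : a ≠ 0) (hb : b ≠ 0) :
    (Nat.lcm a b).primeFactors = a.primeFactors ∪ b.primeFactors := by
  ext p
  simp only [Finset.mem_union, Nat.mem_primeFactors_of_ne_zero, ha, hb, Nat.lcm_ne_zero ha hb,
    ne_eq, not_false_eq_true, ← and_or_left]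
  exact and_congr_right fun hp => hp.prime.dvd_lcm

theorem psi_lcm_eq_psi_mul_psiM {m n : ℕ} (hm : m ≠ 0) (hn : n ≠ 0) :
    psi (Nat.lcm n m) = psi m * psiM m n := by
  unfold psi psiM
  rw [primeFactors_lcm_eq_union hn hm, ← Finset.prod_union]
  · congr 1
    ext p
    simp only [Finset.mem_union, Finset.mem_filter, Nat.mem_primeFactors]
    tauto
  · rw [Finset.disjoint_left]
    intro p hp hq
    exact (Finset.mem_filter.1 hq).2 (Nat.dvd_of_mem_primeFactors hp)

theorem psiM_lcm_mul_psiM_gcd (m : ℕ) {d t : ℕ} (hd : d ≠ 0) (ht : t ≠ 0) :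
    psiM m (Nat.lcm d t) * psiM m (Nat.gcd d t) = psiM m d * psiM m t := by
  unfold psiM
  rw [primeFactors_lcm_eq_union hd ht, Nat.primeFactors_gcd hd ht, Finset.filter_union,
    Finset.filter_inter_distrib, Finset.prod_union_inter]

theorem psiM_mul_of_coprime {m k δ : ℕ} (hk : Nat.Coprime k δ) (hδ : Nat.Coprime δ m) :
    psiM m (k * δ) = psiM m k * psi δ := by
  unfold psiM psi
  rw [hk.primeFactors_mul, Finset.filter_union, Finset.prod_union
    (Finset.disjoint_filter_filter hk.disjoint_primeFactors)]
  congr 2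
  refine Finset.filter_true_of_mem fun p hp hpm => ?_
  have hp' := Nat.prime_of_mem_primeFactors hp
  exact hp'.one_lt.ne' (Nat.dvd_one.1 (hδ ▸ Nat.dvd_gcd (Nat.dvd_of_mem_primeFactors hp) hpm))

/-- The arithmetic function `δ ↦ δ` restricted to `δ` coprime to `m`. -/
def idCoprime (m : ℕ) : ArithmeticFunction ℕ :=
  ⟨fun δ => if Nat.Coprime δ m then δ else 0, by simp⟩

theorem idCoprime_apply (m δ : ℕ) : idCoprime m δ = if Nat.Coprime δ m then δ else 0 := rfl

theorem isMultiplicative_idCoprime (m : ℕ) : (idCoprime m).IsMultiplicative := by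
  refine ⟨by simp [idCoprime_apply], fun {a b} _ => ?_⟩
  simp only [idCoprime_apply, Nat.coprime_mul_iff_left]
  split_ifs <;> simp_all

theorem psiM_eq_sum_divisors (m : ℕ) {g : ℕ} (hg : Squarefree g) :
    psiM m g = ∑ δ ∈ g.divisors with Nat.gcd δ m = 1, δ := by
  have h := (isMultiplicative_idCoprime m).prodPrimeFactors_one_add_of_squarefree hg
  rw [Finset.sum_filter]
  refine Eq.trans ?_ h
  unfold psiM
  rw [Finset.prod_filter]
  refine Finset.prod_congr rfl fun p hp => ?_
  simp only [idCoprime_apply, (Nat.prime_of_mem_primeFactors hp).coprime_iff_not_dvd]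
  split_ifs <;> simp [add_comm]

theorem sum_Icc_filter_dvd {δ : ℕ} (hδ : 0 < δ) (N : ℕ) (F : ℕ → ℝ) :
    ∑ d ∈ Finset.Icc 1 N with δ ∣ d, F d = ∑ k ∈ Finset.Icc 1 (N / δ), F (k * δ) := by
  symm
  refine Finset.sum_nbij (· * δ) ?_ ?_ ?_ fun _ _ => rfl
  · intro k hk
    simp only [Finset.mem_Icc, Finset.mem_filter] at hk ⊢
    exact ⟨⟨Nat.mul_pos hk.1 hδ, (Nat.le_div_iff_mul_le hδ).1 hk.2⟩, dvd_mul_left _ _⟩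
  · exact fun a _ b _ h => Nat.eq_of_mul_eq_mul_right hδ h
  · intro d hd
    simp only [Finset.coe_filter, Finset.mem_Icc, Set.mem_ofPred_eq] at hd
    obtain ⟨⟨h1, h2⟩, k, rfl⟩ := hd
    refine ⟨k, ?_, mul_comm _ _⟩
    simp only [Finset.coe_Icc, Set.mem_Icc]
    exact ⟨Nat.pos_of_mul_pos_left h1, (Nat.le_div_iff_mul_le hδ).2 (by rwa [mul_comm])⟩

theorem moebius_mul_moebius_div_psi_lcm {m N d t : ℕ} (hm : m ≠ 0)
    (hd : d ∈ Finset.Icc 1 N) (ht : t ∈ Finset.Icc 1 N) :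
    ((ArithmeticFunction.moebius d : ℝ) * (ArithmeticFunction.moebius t : ℝ)) /
        (psi (Nat.lcm (Nat.lcm d t) m) : ℝ) =
      1 / (psi m : ℝ) * ∑ δ ∈ Finset.Icc 1 N with Nat.gcd δ m = 1,
        (δ : ℝ) * ((if δ ∣ d then (ArithmeticFunction.moebius d : ℝ) / psiM m d else 0) *
          (if δ ∣ t then (ArithmeticFunction.moebius t : ℝ) / psiM m t else 0)) := by
  rw [Finset.mem_Icc] at hd ht
  have hd0 : d ≠ 0 := by omega
  have ht0 : t ≠ 0 := by omega
  by_cases hsq : Squarefree d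
  swap
  · simp [ArithmeticFunction.moebius_eq_zero_of_not_squarefree hsq]
  have hsum : ((psiM m (Nat.gcd d t) : ℕ) : ℝ) =
      ∑ δ ∈ Finset.Icc 1 N with Nat.gcd δ m = 1, if δ ∣ d ∧ δ ∣ t then (δ : ℝ) else 0 := by
    rw [psiM_eq_sum_divisors m (hsq.squarefree_of_dvd (Nat.gcd_dvd_left d t)), Nat.cast_sum,
      ← Finset.sum_filter]
    refine Finset.sum_congr ?_ fun _ _ => rfl
    ext δ
    simp only [Finset.mem_filter, Nat.mem_divisors, Finset.mem_Icc, Nat.dvd_gcd_iff]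
    constructor
    · rintro ⟨⟨h, -⟩, hc⟩
      exact ⟨⟨⟨Nat.pos_of_dvd_of_pos h.1 hd.1, (Nat.le_of_dvd hd.1 h.1).trans hd.2⟩, hc⟩, h⟩
    · rintro ⟨⟨-, hc⟩, h⟩
      exact ⟨⟨h, Nat.gcd_ne_zero_left hd0⟩, hc⟩
  have hterm : ∀ δ : ℕ,
      (δ : ℝ) * ((if δ ∣ d then (ArithmeticFunction.moebius d : ℝ) / psiM m d else 0) *
          (if δ ∣ t then (ArithmeticFunction.moebius t : ℝ) / psiM m t else 0)) =
        (if δ ∣ d ∧ δ ∣ t then (δ : ℝ) else 0) *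
          ((ArithmeticFunction.moebius d : ℝ) / psiM m d *
            ((ArithmeticFunction.moebius t : ℝ) / psiM m t)) := by
    intro δ
    by_cases h1 : δ ∣ d <;> by_cases h2 : δ ∣ t <;> simp [h1, h2]
  simp_rw [hterm]
  rw [← Finset.sum_mul, ← hsum, psi_lcm_eq_psi_mul_psiM hm (Nat.lcm_ne_zero hd0 ht0)]
  have key : (psiM m (Nat.lcm d t) : ℝ) * psiM m (Nat.gcd d t) = psiM m d * psiM m t :=
    mod_cast psiM_lcm_mul_psiM_gcd m hd0 ht0
  have h1 : (psi m : ℝ) ≠ 0 := mod_cast (psi_pos m).ne'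
  have h2 : (psiM m (Nat.lcm d t) : ℝ) ≠ 0 := mod_cast (psiM_pos m _).ne'
  have h3 : (psiM m d : ℝ) ≠ 0 := mod_cast (psiM_pos m _).ne'
  have h4 : (psiM m t : ℝ) ≠ 0 := mod_cast (psiM_pos m _).ne'
  push_cast
  field_simp
  linear_combination -(ArithmeticFunction.moebius t : ℝ) * key

theorem moebius_mul_div_psiM {m δ : ℕ} (hδ : Nat.Coprime δ m) (k : ℕ) :
    (ArithmeticFunction.moebius (k * δ) : ℝ) / psiM m (k * δ) =
      (ArithmeticFunction.moebius (k * δ) : ℝ) / psiM m k / psi δ := by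
  by_cases hsq : Squarefree (k * δ)
  · rw [psiM_mul_of_coprime (Nat.coprime_of_squarefree_mul hsq) hδ, Nat.cast_mul, div_div]
  · simp [ArithmeticFunction.moebius_eq_zero_of_not_squarefree hsq]

theorem moebius_sq_mul_moebius_mul (k δ : ℕ) :
    (ArithmeticFunction.moebius δ : ℝ) ^ 2 * (ArithmeticFunction.moebius (k * δ) : ℝ) =
      (ArithmeticFunction.moebius (k * δ) : ℝ) := by
  by_cases hsq : Squarefree (k * δ)
  · have h := ArithmeticFunction.moebius_sq_eq_one_of_squarefree
      (hsq.squarefree_of_dvd (dvd_mul_left δ k))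
    have h' : (ArithmeticFunction.moebius δ : ℝ) ^ 2 = 1 := mod_cast h
    rw [h', one_mul]
  · simp [ArithmeticFunction.moebius_eq_zero_of_not_squarefree hsq]

theorem sum_moebius_div_psiM_sq {m δ : ℕ} (hδ : Nat.Coprime δ m) (hpos : 0 < δ) (N : ℕ) :
    (∑ d ∈ Finset.Icc 1 N,
        if δ ∣ d then (ArithmeticFunction.moebius d : ℝ) / psiM m d else 0) ^ 2 =
      (ArithmeticFunction.moebius δ : ℝ) ^ 2 / (psi δ : ℝ) ^ 2 *
        (∑ k ∈ Finset.Icc 1 (N / δ), (ArithmeticFunction.moebius (k * δ) : ℝ) / psiM m k) ^ 2 := by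
  rw [← Finset.sum_filter, sum_Icc_filter_dvd hpos]
  simp_rw [moebius_mul_div_psiM hδ]
  rw [← Finset.sum_div]
  set A := ∑ k ∈ Finset.Icc 1 (N / δ), (ArithmeticFunction.moebius (k * δ) : ℝ) / psiM m k with hA
  have h : (ArithmeticFunction.moebius δ : ℝ) ^ 2 * A = A := by
    rw [hA, Finset.mul_sum]
    exact Finset.sum_congr rfl fun k _ => by rw [← mul_div_assoc, moebius_sq_mul_moebius_mul]
  rw [div_pow, div_mul_eq_mul_div]
  congr 1
  linear_combination -A * h

theorem stmt8 :
    ∀ m : ℕ, 1 ≤ m → ∀ y : ℝ, 1 ≤ y →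
      T y m = (6 / (Real.pi ^ 2 * (psi m : ℝ))) *
        ∑ δ ∈ (Finset.Icc 1 ⌊y⌋₊).filter (fun δ : ℕ => Nat.gcd δ m = 1),
          ((δ : ℝ) * (ArithmeticFunction.moebius δ : ℝ) ^ 2 / (psi δ : ℝ) ^ 2) *
            (∑ d ∈ Finset.Icc 1 ⌊y / (δ : ℝ)⌋₊,
              (ArithmeticFunction.moebius (d * δ) : ℝ) / (psiM m d : ℝ)) ^ 2 := by
  intro m hm y _
  have hm0 : m ≠ 0 := by omega
  unfold T
  rw [Finset.sum_congr rfl fun d hd => Finset.sum_congr rfl fun t ht =>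
    moebius_mul_moebius_div_psi_lcm hm0 hd ht]
  simp_rw [← Finset.mul_sum]
  rw [← mul_assoc, show 6 / Real.pi ^ 2 * (1 / (psi m : ℝ)) = 6 / (Real.pi ^ 2 * (psi m : ℝ)) by
    rw [div_mul_div_comm, mul_one]]
  congr 1
  simp_rw [Finset.sum_comm (s := Finset.Icc 1 ⌊y⌋₊)
    (t := (Finset.Icc 1 ⌊y⌋₊).filter fun δ : ℕ => Nat.gcd δ m = 1)]
  refine Finset.sum_congr rfl fun δ hδ => ?_
  rw [Finset.mem_filter, Finset.mem_Icc] at hδ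
  simp_rw [← Finset.mul_sum]
  rw [← Finset.sum_mul, ← sq, sum_moebius_div_psiM_sq hδ.2 hδ.1.1, Nat.floor_div_natCast]
  ring
end

section
/- There exists a constant C > 0 such that for all integers n ≥ 1, all real y ≥ 3, and all integers j with 1 ≤ j ≤ y^{1/4}, one has |∑_{y/(j+1) < δ ≤ y/j, gcd(δ, n) = 1} δ·μ(δ)²/ψ(δ)² − B·log(1 + 1/j)·α(n)| ≤ C·r(n)·j^{3/8}/y^{3/8}, where B := ∏_p (1 − (3p + 1)/(p(p + 1)²)) and α(n) := ∏_{p | n} (1 − p/(p² + 3p + 1)). -/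
open Finset MeasureTheory Filter

open ArithmeticFunction in
/-- The multiplicative function `d ↦ d² μ(d)² / ψ(d)²` restricted to `d` coprime to `n`. -/
noncomputable def psiWeight (n : ℕ) : ArithmeticFunction ℝ where
  toFun d := if Nat.gcd d n = 1 then ((d : ℝ) * (moebius d : ℝ) / (psi d : ℝ)) ^ 2 else 0
  map_zero' := by simp

open ArithmeticFunction in
/-- The Dirichlet convolution of `psiWeight n` with the Möbius function. -/
noncomputable def psiCoeff (n : ℕ) : ArithmeticFunction ℝ :=
  psiWeight n * (moebius : ArithmeticFunction ℝ)

/-- The arithmetic function `n ↦ 1 / n`. -/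
noncomputable def invNat : ArithmeticFunction ℝ where
  toFun n := (n : ℝ)⁻¹
  map_zero' := by simp

theorem psi_mul {a b : ℕ} (h : a.Coprime b) : psi (a * b) = psi a * psi b := by
  rw [psi, h.primeFactors_mul, Finset.prod_union h.disjoint_primeFactors, psi, psi]

theorem psi_prime {p : ℕ} (hp : p.Prime) : psi p = p + 1 := by
  simp [psi, hp.primeFactors]

theorem psiWeight_apply (n d : ℕ) : psiWeight n d =
    if Nat.gcd d n = 1 then
      ((d : ℝ) * (ArithmeticFunction.moebius d : ℝ) / (psi d : ℝ)) ^ 2 else 0 := rfl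

theorem isMultiplicative_psiWeight (n : ℕ) : (psiWeight n).IsMultiplicative := by
  refine ⟨by simp [psiWeight_apply, psi], fun {a b} hab => ?_⟩
  have hc : Nat.gcd (a * b) n = 1 ↔ Nat.gcd a n = 1 ∧ Nat.gcd b n = 1 :=
    Nat.coprime_mul_iff_left
  simp only [psiWeight_apply, hc, psi_mul hab,
    ArithmeticFunction.isMultiplicative_moebius.map_mul_of_coprime hab]
  by_cases h₁ : Nat.gcd a n = 1 <;> by_cases h₂ : Nat.gcd b n = 1 <;> simp [h₁, h₂]
  ring

theorem isMultiplicative_psiCoeff (n : ℕ) : (psiCoeff n).IsMultiplicative :=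
  (isMultiplicative_psiWeight n).mul ArithmeticFunction.isMultiplicative_moebius.intCast

theorem psiCoeff_mul_zeta (n : ℕ) :
    psiCoeff n * (ArithmeticFunction.zeta : ArithmeticFunction ℝ) = psiWeight n := by
  rw [psiCoeff, mul_assoc, ArithmeticFunction.coe_moebius_mul_coe_zeta, mul_one]

theorem psiCoeff_prime_pow_succ (n k : ℕ) {p : ℕ} (hp : p.Prime) :
    psiCoeff n (p ^ (k + 1)) = psiWeight n (p ^ (k + 1)) - psiWeight n (p ^ k) := by
  have key (j : ℕ) : psiWeight n (p ^ j) = ∑ i ∈ Finset.range (j + 1), psiCoeff n (p ^ i) := by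
    rw [← psiCoeff_mul_zeta, ArithmeticFunction.coe_mul_zeta_apply, Nat.sum_divisors_prime_pow hp]
  rw [key, key, Finset.sum_range_succ _ (k + 1)]
  ring

theorem psiWeight_prime (n : ℕ) {p : ℕ} (hp : p.Prime) :
    psiWeight n p = if p ∣ n then 0 else ((p : ℝ) / (p + 1)) ^ 2 := by
  have h : Nat.gcd p n = 1 ↔ ¬ p ∣ n := hp.coprime_iff_not_dvd
  by_cases hd : p ∣ n
  · simp [psiWeight_apply, h, hd]
  · simp [psiWeight_apply, h, hd, psi_prime hp, ArithmeticFunction.moebius_apply_prime hp, neg_div]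

theorem psiWeight_prime_pow (n k : ℕ) {p : ℕ} (hp : p.Prime) :
    psiWeight n (p ^ (k + 2)) = 0 := by
  have : ArithmeticFunction.moebius (p ^ (k + 2)) = 0 := by
    rw [ArithmeticFunction.moebius_apply_prime_pow hp (by omega)]
    simp
  simp [psiWeight_apply, this]

theorem psiCoeff_one (n : ℕ) : psiCoeff n 1 = 1 := (isMultiplicative_psiCoeff n).map_one

theorem psiCoeff_prime (n : ℕ) {p : ℕ} (hp : p.Prime) :
    psiCoeff n p = psiWeight n p - 1 := by
  simpa [(isMultiplicative_psiWeight n).map_one] using psiCoeff_prime_pow_succ n 0 hp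

theorem psiCoeff_prime_sq (n : ℕ) {p : ℕ} (hp : p.Prime) :
    psiCoeff n (p ^ 2) = -psiWeight n p := by
  simpa [psiWeight_prime_pow n 0 hp] using psiCoeff_prime_pow_succ n 1 hp

theorem psiCoeff_prime_pow (n k : ℕ) (hk : 3 ≤ k) {p : ℕ} (hp : p.Prime) :
    psiCoeff n (p ^ k) = 0 := by
  obtain ⟨m, rfl⟩ := Nat.exists_eq_add_of_le' hk
  rw [show m + 3 = (m + 2) + 1 from rfl, psiCoeff_prime_pow_succ n (m + 2) hp,
    psiWeight_prime_pow n m hp, psiWeight_prime_pow n (m + 1) hp, sub_zero]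

/-- A series over prime powers of a function vanishing at cubes and above has three terms. -/
theorem hasSum_prime_pow {f : ℕ → ℝ} {p : ℕ} (hf : ∀ k, 3 ≤ k → f (p ^ k) = 0) :
    HasSum (fun k => f (p ^ k)) (f 1 + f p + f (p ^ 2)) := by
  have := hasSum_sum_of_ne_finset_zero (f := fun k => f (p ^ k)) (s := Finset.range 3)
    (L := SummationFilter.unconditional _)
    (fun k hk => hf k (by simpa using hk))
  simpa [Finset.sum_range_succ] using this

/-- Partial sums of a nonnegative multiplicative function are bounded by partial Euler products. -/
theorem sum_le_prod_prime_tsum {f : ℕ → ℝ} (hf₀ : f 0 = 0) (hf₁ : f 1 = 1)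
    (hmul : ∀ {m n}, Nat.Coprime m n → f (m * n) = f m * f n) (hnn : ∀ n, 0 ≤ f n)
    (hsum : ∀ {p : ℕ}, p.Prime → Summable fun k => ‖f (p ^ k)‖) (u : Finset ℕ) :
    ∃ s : Finset ℕ, ∑ d ∈ u, f d ≤ ∏ p ∈ s with p.Prime, ∑' k, f (p ^ k) := by
  classical
  refine ⟨u.biUnion Nat.primeFactors, ?_⟩
  set s := u.biUnion Nat.primeFactors
  have h := (EulerProduct.summable_and_hasSum_factoredNumbers_prod_filter_prime_tsum
    hf₁ hmul hsum s).2
  have hu : ∑ d ∈ u, f d = ∑ d ∈ u.filter (· ≠ 0), f d :=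
    by
    refine (Finset.sum_filter_of_ne fun d _ hd => ?_).symm
    rintro rfl
    exact hd hf₀
  have hmem : ∀ d ∈ u.filter (· ≠ 0), d ∈ Nat.factoredNumbers s := fun d hd => by
    rw [Finset.mem_filter] at hd
    exact Nat.mem_factoredNumbers_of_primeFactors_subset hd.2
      (Finset.subset_biUnion_of_mem Nat.primeFactors hd.1)
  rw [hu, ← Finset.sum_subtype_of_mem f hmem]
  exact sum_le_hasSum _ (fun d _ => hnn d) h

/-- The absolute value of `psiCoeff n d`, twisted by `d ^ (-5/8)`. -/
noncomputable def psiCoeffAbs (n d : ℕ) : ℝ := |psiCoeff n d| * (d : ℝ) ^ (-(5 / 8) : ℝ)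

theorem psiCoeffAbs_nonneg (n d : ℕ) : 0 ≤ psiCoeffAbs n d := by
  unfold psiCoeffAbs; positivity

theorem psiCoeffAbs_mul (n : ℕ) {a b : ℕ} (h : a.Coprime b) :
    psiCoeffAbs n (a * b) = psiCoeffAbs n a * psiCoeffAbs n b := by
  unfold psiCoeffAbs
  rw [(isMultiplicative_psiCoeff n).map_mul_of_coprime h, abs_mul, Nat.cast_mul,
    Real.mul_rpow (by positivity) (by positivity)]
  ring

theorem hasSum_psiCoeffAbs_prime_pow (n : ℕ) {p : ℕ} (hp : p.Prime) :
    HasSum (fun k => psiCoeffAbs n (p ^ k))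
      (psiCoeffAbs n 1 + psiCoeffAbs n p + psiCoeffAbs n (p ^ 2)) :=
  hasSum_prime_pow fun k hk => by simp [psiCoeffAbs, psiCoeff_prime_pow n k hk hp]

theorem tsum_psiCoeffAbs_prime_pow_le (n : ℕ) {p : ℕ} (hp : p.Prime) :
    ∑' k, psiCoeffAbs n (p ^ k) ≤
      (1 + 3 * (p : ℝ) ^ (-(5 / 4) : ℝ)) * if p ∣ n then 1 + 2 / √(p : ℝ) else 1 := by
  rw [(hasSum_psiCoeffAbs_prime_pow n hp).tsum_eq]
  have hp1 : (1 : ℝ) ≤ p := by exact_mod_cast hp.one_le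
  have hp0 : (0 : ℝ) < p := by linarith
  simp only [psiCoeffAbs, psiCoeff_one, psiCoeff_prime_sq n hp, psiCoeff_prime n hp,
    psiWeight_prime n hp]
  have hsq : ((p ^ 2 : ℕ) : ℝ) ^ (-(5 / 8) : ℝ) = (p : ℝ) ^ (-(5 / 4) : ℝ) := by
    rw [Nat.cast_pow, ← Real.rpow_natCast, ← Real.rpow_mul hp0.le]
    norm_num
  have h54 : 0 < (p : ℝ) ^ (-(5 / 4) : ℝ) := by positivity
  rw [hsq]
  split_ifs with hd
  · have h1 : (p : ℝ) ^ (-(5 / 8) : ℝ) ≤ 1 / √(p : ℝ) := by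
      rw [Real.sqrt_eq_rpow, one_div, ← Real.rpow_neg hp0.le]
      exact Real.rpow_le_rpow_of_exponent_le hp1 (by norm_num)
    have h2 : 0 < 1 / √(p : ℝ) := by positivity
    have h3 : 2 / √(p : ℝ) = 2 * (1 / √(p : ℝ)) := by ring
    simp only [zero_sub, abs_neg, abs_one, Nat.cast_one, Real.one_rpow, neg_zero, abs_zero]
    rw [h3]
    nlinarith [mul_pos h54 h2]
  · have hw : ((p : ℝ) / (p + 1)) ^ 2 ≤ 1 := by
      rw [div_pow, div_le_one (by positivity)]
      nlinarith
    have hw' : 1 - ((p : ℝ) / (p + 1)) ^ 2 ≤ 2 * (p : ℝ) ^ (-1 : ℝ) := by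
      rw [Real.rpow_neg_one, div_pow, one_sub_div (by positivity), ← div_eq_mul_inv,
        div_le_div_iff₀ (by positivity) hp0]
      nlinarith
    have h58 : (p : ℝ) ^ (-1 : ℝ) * (p : ℝ) ^ (-(5 / 8) : ℝ) ≤ (p : ℝ) ^ (-(5 / 4) : ℝ) := by
      rw [← Real.rpow_add hp0]
      exact Real.rpow_le_rpow_of_exponent_le hp1 (by norm_num)
    have h0 : 0 ≤ (p : ℝ) ^ (-(5 / 8) : ℝ) := by positivity
    rw [abs_neg, abs_of_nonneg (sq_nonneg ((p : ℝ) / (p + 1))), abs_one,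
      abs_of_nonpos (sub_nonpos.2 hw)]
    simp only [Nat.cast_one, Real.one_rpow]
    nlinarith [mul_le_mul_of_nonneg_right hw' h0, mul_le_mul_of_nonneg_right hw h54.le]

theorem sum_psiCoeffAbs_le {n : ℕ} (hn : n ≠ 0) (u : Finset ℕ) :
    ∑ d ∈ u, psiCoeffAbs n d ≤
      Real.exp (∑' k : ℕ, 3 * (k : ℝ) ^ (-(5 / 4) : ℝ)) * rfun n := by
  classical
  obtain ⟨s, hs⟩ := sum_le_prod_prime_tsum (f := psiCoeffAbs n) (by simp [psiCoeffAbs])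
    (by simp [psiCoeffAbs, psiCoeff_one]) (psiCoeffAbs_mul n) (psiCoeffAbs_nonneg n)
    (fun hp => (hasSum_psiCoeffAbs_prime_pow n hp).summable.norm) u
  have hsum : Summable fun k : ℕ => 3 * (k : ℝ) ^ (-(5 / 4) : ℝ) :=
    (Real.summable_nat_rpow.2 (by norm_num)).mul_left 3
  refine hs.trans ((Finset.prod_le_prod (fun p _ => tsum_nonneg fun k => psiCoeffAbs_nonneg n _)
    fun p hp => tsum_psiCoeffAbs_prime_pow_le n (Finset.mem_filter.1 hp).2).trans ?_)
  rw [Finset.prod_mul_distrib]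
  refine mul_le_mul ?_ ?_ (Finset.prod_nonneg fun p _ => ?_) (Real.exp_nonneg _)
  · refine (Real.prod_one_add_le_exp_sum _ fun p => ?_).trans
      (Real.exp_le_exp.2 (hsum.sum_le_tsum _ fun k _ => ?_)) <;> positivity
  · have hone (p : ℕ) : 1 ≤ 1 + 2 / √(p : ℝ) := le_add_of_nonneg_right (by positivity)
    have hsub : {p ∈ {p ∈ s | p.Prime} | p ∣ n} ⊆ n.primeFactors := fun p hp => by
      simp only [Finset.mem_filter] at hp
      exact Nat.mem_primeFactors.2 ⟨hp.1.2, hp.2, hn⟩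
    rw [← Finset.prod_filter, rfun, ← Finset.prod_sdiff hsub]
    exact le_mul_of_one_le_left (Finset.prod_nonneg fun p _ => zero_le_one.trans (hone p))
      (Finset.one_le_prod fun p _ => hone p)
  · split_ifs <;> positivity

theorem summable_psiCoeffAbs {n : ℕ} (hn : n ≠ 0) : Summable (psiCoeffAbs n) :=
  summable_of_sum_le (psiCoeffAbs_nonneg n) (sum_psiCoeffAbs_le hn)

theorem abs_psiCoeff_div_le (n d : ℕ) : |psiCoeff n d * (d : ℝ)⁻¹| ≤ psiCoeffAbs n d := by
  rcases Nat.eq_zero_or_pos d with rfl | hd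
  · simp [psiCoeffAbs]
  · have hd1 : (1 : ℝ) ≤ d := by exact_mod_cast hd
    rw [abs_mul, psiCoeffAbs, abs_of_nonneg (by positivity : 0 ≤ (d : ℝ)⁻¹), ← Real.rpow_neg_one]
    gcongr
    norm_num

theorem summable_psiCoeff_div {n : ℕ} (hn : n ≠ 0) :
    Summable fun d : ℕ => psiCoeff n d * (d : ℝ)⁻¹ :=
  (summable_psiCoeffAbs hn).of_norm_bounded (abs_psiCoeff_div_le n)

theorem hasProd_psiCoeff_div {n : ℕ} (hn : n ≠ 0) :
    HasProd (fun p : Nat.Primes =>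
        (1 - (3 * ((p : ℕ) : ℝ) + 1) / (((p : ℕ) : ℝ) * (((p : ℕ) : ℝ) + 1) ^ 2)) *
          if (p : ℕ) ∣ n then
            1 - ((p : ℕ) : ℝ) / (((p : ℕ) : ℝ) ^ 2 + 3 * ((p : ℕ) : ℝ) + 1) else 1)
      (∑' d : ℕ, psiCoeff n d * (d : ℝ)⁻¹) := by
  have h := EulerProduct.eulerProduct_hasProd (f := fun d : ℕ => psiCoeff n d * (d : ℝ)⁻¹)
    (by simp [psiCoeff_one])
    (fun {a b} hab => by
      simp only [(isMultiplicative_psiCoeff n).map_mul_of_coprime hab, Nat.cast_mul, mul_inv]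
      ring)
    (summable_psiCoeff_div hn).norm (by simp)
  refine Eq.subst (motive := fun f => HasProd f _) (funext fun p => ?_) h
  obtain ⟨p, hp⟩ := p
  have hp0 : (0 : ℝ) < p := by exact_mod_cast hp.pos
  rw [(hasSum_prime_pow (f := fun d : ℕ => psiCoeff n d * (d : ℝ)⁻¹)
    fun k hk => by simp [psiCoeff_prime_pow n k hk hp]).tsum_eq]
  simp only [psiCoeff_one, psiCoeff_prime_sq n hp, psiCoeff_prime n hp, psiWeight_prime n hp]
  have h3 : (p : ℝ) ^ 2 + 3 * p + 1 ≠ 0 := by positivity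
  split_ifs
  · push_cast
    field_simp
    ring
  · push_cast
    field_simp
    ring

theorem hasProd_alpha {n : ℕ} (hn : n ≠ 0) :
    HasProd (fun p : Nat.Primes => if (p : ℕ) ∣ n then
        1 - ((p : ℕ) : ℝ) / (((p : ℕ) : ℝ) ^ 2 + 3 * ((p : ℕ) : ℝ) + 1) else 1) (alpha n) := by
  set g : ℕ → ℝ := fun p => if p ∣ n then 1 - (p : ℝ) / ((p : ℝ) ^ 2 + 3 * (p : ℝ) + 1) else 1
  have h := hasProd_prod_of_ne_finset_one
    (s := n.primeFactors.preimage (fun p : Nat.Primes => (p : ℕ)) Nat.Primes.coe_nat_injective.injOn)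
    (f := fun p : Nat.Primes => g p) (L := SummationFilter.unconditional _)
    (fun p hp => if_neg fun hd =>
      hp (Finset.mem_preimage.2 (Nat.mem_primeFactors.2 ⟨p.2, hd, hn⟩)))
  have hprod := Finset.prod_preimage (fun p : Nat.Primes => (p : ℕ)) n.primeFactors
    Nat.Primes.coe_nat_injective.injOn g
    fun p hp hp' => absurd ⟨⟨p, Nat.prime_of_mem_primeFactors hp⟩, rfl⟩ hp'
  have halpha : ∏ p ∈ n.primeFactors, g p = alpha n :=
    Finset.prod_congr rfl fun p hp => if_pos (Nat.dvd_of_mem_primeFactors hp)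
  exact (hprod.trans halpha) ▸ h

theorem tsum_psiCoeff_div {n : ℕ} (hn : n ≠ 0) :
    ∑' d : ℕ, psiCoeff n d * (d : ℝ)⁻¹ = Bconst * alpha n := by
  have hB : HasProd (fun p : Nat.Primes =>
      (1 - (3 * ((p : ℕ) : ℝ) + 1) / (((p : ℕ) : ℝ) * (((p : ℕ) : ℝ) + 1) ^ 2))) Bconst := by
    have h := hasProd_psiCoeff_div one_ne_zero
    refine Multipliable.hasProd (h.multipliable.congr fun p => ?_)
    simp [p.2.ne_one]
  exact (hasProd_psiCoeff_div hn).unique (hB.mul (hasProd_alpha hn))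

theorem sum_Ioc_inv_le_log {M N : ℕ} (hM : 1 ≤ M) (h : M ≤ N) :
    ∑ m ∈ Finset.Ioc M N, (m : ℝ)⁻¹ ≤ Real.log N - Real.log M := by
  induction N, h using Nat.le_induction with
  | base => simp
  | succ N h ih =>
    have hN : (0 : ℝ) < N := by exact_mod_cast hM.trans h
    rw [Finset.sum_Ioc_succ_top h]
    have := Real.one_sub_inv_le_log_of_pos (x := ((N + 1 : ℕ) : ℝ) / N) (by positivity)
    rw [Real.log_div (by positivity) hN.ne'] at this
    have h2 : 1 - (((N + 1 : ℕ) : ℝ) / N)⁻¹ = ((N + 1 : ℕ) : ℝ)⁻¹ := by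
      push_cast
      field_simp
      ring
    linarith

theorem log_le_sum_Ioc_inv {M N : ℕ} (h : M ≤ N) :
    Real.log (N + 1) - Real.log (M + 1) ≤ ∑ m ∈ Finset.Ioc M N, (m : ℝ)⁻¹ := by
  induction N, h using Nat.le_induction with
  | base => simp
  | succ N h ih =>
    rw [Finset.sum_Ioc_succ_top h]
    have := Real.log_le_sub_one_of_pos (x := ((N : ℝ) + 1 + 1) / (N + 1)) (by positivity)
    rw [Real.log_div (by positivity) (by positivity)] at this
    have h2 : ((N : ℝ) + 1 + 1) / (N + 1) - 1 = ((N + 1 : ℕ) : ℝ)⁻¹ := by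
      push_cast
      field_simp
      ring
    push_cast at *
    linarith

theorem abs_sum_Ioc_inv_sub_log_le {u v : ℝ} (hu : 0 < u) (huv : u ≤ v) (hv : v ≤ 2 * u) :
    |∑ m ∈ Finset.Ioc ⌊u⌋₊ ⌊v⌋₊, (m : ℝ)⁻¹ - Real.log (v / u)| ≤ 2 * u ^ (-(3 / 8) : ℝ) := by
  have hv0 : 0 < v := hu.trans_le huv
  have hle : ⌊u⌋₊ ≤ ⌊v⌋₊ := Nat.floor_mono huv
  rcases lt_or_ge u 1 with h1 | h1
  · have hU : ⌊u⌋₊ = 0 := Nat.floor_eq_zero.2 h1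
    have hV : ⌊v⌋₊ ≤ 1 := Nat.lt_succ_iff.1 ((Nat.floor_lt hv0.le).2 (by push_cast; linarith))
    have hlog0 : 0 ≤ Real.log (v / u) := Real.log_nonneg ((one_le_div hu).2 huv)
    have hlog1 : Real.log (v / u) ≤ 1 := by
      have := Real.log_le_sub_one_of_pos (div_pos hv0 hu)
      have h2 : v / u ≤ 2 := (div_le_iff₀ hu).2 hv
      linarith
    have hpow : 1 ≤ u ^ (-(3 / 8) : ℝ) :=
      Real.one_le_rpow_of_pos_of_le_one_of_nonpos hu h1.le (by norm_num)
    have hs : 0 ≤ ∑ m ∈ Finset.Ioc ⌊u⌋₊ ⌊v⌋₊, (m : ℝ)⁻¹ ∧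
        ∑ m ∈ Finset.Ioc ⌊u⌋₊ ⌊v⌋₊, (m : ℝ)⁻¹ ≤ 1 := by
      rw [hU]
      interval_cases ⌊v⌋₊ <;> simp
    rw [abs_le]
    constructor <;> linarith
  · have hM : 1 ≤ ⌊u⌋₊ := (Nat.one_le_floor_iff u).2 h1
    have hM0 : (0 : ℝ) < ⌊u⌋₊ := by exact_mod_cast hM
    have hN0 : (0 : ℝ) < ⌊v⌋₊ := by exact_mod_cast hM.trans hle
    have hup := sum_Ioc_inv_le_log hM hle
    have hlo := log_le_sum_Ioc_inv hle
    have hpow : u⁻¹ ≤ u ^ (-(3 / 8) : ℝ) := by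
      rw [← Real.rpow_neg_one]
      exact Real.rpow_le_rpow_of_exponent_le h1 (by norm_num)
    have hlt := Nat.lt_floor_add_one u
    have hfl := Nat.floor_le hu.le
    rw [Real.log_div hv0.ne' hu.ne', abs_le]
    constructor
    · have a1 : Real.log v ≤ Real.log (⌊v⌋₊ + 1) :=
        Real.log_le_log hv0 (Nat.lt_floor_add_one v).le
      have a2 : Real.log (⌊u⌋₊ + 1) ≤ Real.log (u + 1) :=
        Real.log_le_log (by positivity) (by linarith)
      have a3 := Real.log_le_sub_one_of_pos (x := (u + 1) / u) (by positivity)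
      rw [Real.log_div (by positivity) hu.ne', add_div, div_self hu.ne', one_div] at a3
      have : 0 < u⁻¹ := by positivity
      linarith
    · have a1 : Real.log ⌊v⌋₊ ≤ Real.log v := Real.log_le_log hN0 (Nat.floor_le hv0.le)
      have a2 := Real.log_le_sub_one_of_pos (x := u / ⌊u⌋₊) (by positivity)
      rw [Real.log_div hu.ne' hM0.ne'] at a2
      have a3 : u / ⌊u⌋₊ - 1 ≤ 2 * u⁻¹ := by
        have hM1 : (1 : ℝ) ≤ ⌊u⌋₊ := by exact_mod_cast hM
        rw [← div_eq_mul_inv, sub_le_iff_le_add, div_add_one hu.ne', div_le_div_iff₀ hM0 hu]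
        nlinarith
      linarith

theorem hasSum_psiCoeff_mul_harmonic (n N : ℕ) :
    HasSum (fun d : ℕ => psiCoeff n d * (d : ℝ)⁻¹ * ∑ m ∈ Finset.Ioc 0 (N / d), (m : ℝ)⁻¹)
      (∑ δ ∈ Finset.Ioc 0 N, psiWeight n δ * (δ : ℝ)⁻¹) := by
  have hconv : (psiCoeff n).pmul invNat * invNat = (psiWeight n).pmul invNat := by
    ext δ
    rw [← psiCoeff_mul_zeta]
    simp only [ArithmeticFunction.mul_apply, ArithmeticFunction.pmul_apply, Finset.sum_mul]
    refine Finset.sum_congr rfl fun x hx => ?_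
    obtain ⟨hx, h0⟩ := Nat.mem_divisorsAntidiagonal.1 hx
    have h2 : x.2 ≠ 0 := by
      rintro h2
      simp [h2] at hx
      exact h0 hx.symm
    simp [invNat, ← hx, ArithmeticFunction.zeta_apply, h2]
    ring
  have h := ArithmeticFunction.sum_Ioc_mul_eq_sum_sum ((psiCoeff n).pmul invNat) invNat N
  rw [hconv] at h
  simp only [ArithmeticFunction.pmul_apply] at h
  change ∑ δ ∈ Finset.Ioc 0 N, psiWeight n δ * (δ : ℝ)⁻¹ = ∑ d ∈ Finset.Ioc 0 N,
    psiCoeff n d * (d : ℝ)⁻¹ * ∑ m ∈ Finset.Ioc 0 (N / d), (m : ℝ)⁻¹ at h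
  rw [h]
  refine hasSum_sum_of_ne_finset_zero fun d hd => ?_
  rcases Nat.eq_zero_or_pos d with rfl | hd0
  · simp
  · rw [Nat.div_eq_of_lt (by simp at hd; omega)]
    simp

theorem sum_Ioc_zero_sub {f : ℕ → ℝ} {A B : ℕ} (h : A ≤ B) :
    ∑ i ∈ Finset.Ioc 0 B, f i - ∑ i ∈ Finset.Ioc 0 A, f i = ∑ i ∈ Finset.Ioc A B, f i := by
  rw [← Finset.sum_Ioc_consecutive f (Nat.zero_le A) h]
  ring

theorem abs_sum_psiWeight_sub_le {n : ℕ} (hn : n ≠ 0) {a b : ℝ} (ha : 0 < a) (hab : a ≤ b)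
    (hb : b ≤ 2 * a) :
    |∑ δ ∈ Finset.Ioc ⌊a⌋₊ ⌊b⌋₊, psiWeight n δ * (δ : ℝ)⁻¹ -
        Bconst * alpha n * Real.log (b / a)| ≤
      Real.exp (∑' k : ℕ, 3 * (k : ℝ) ^ (-(5 / 4) : ℝ)) * rfun n * (2 * a ^ (-(3 / 8) : ℝ)) := by
  have hle : ⌊a⌋₊ ≤ ⌊b⌋₊ := Nat.floor_mono hab
  have hsum := ((hasSum_psiCoeff_mul_harmonic n ⌊b⌋₊).sub
    (hasSum_psiCoeff_mul_harmonic n ⌊a⌋₊)).sub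
      ((summable_psiCoeff_div hn).hasSum.mul_right (Real.log (b / a)))
  rw [sum_Ioc_zero_sub hle, tsum_psiCoeff_div hn] at hsum
  have hmaj : HasSum (fun d => psiCoeffAbs n d * (2 * a ^ (-(3 / 8) : ℝ))) _ :=
    (summable_psiCoeffAbs hn).hasSum.mul_right _
  have hpos : 0 ≤ 2 * a ^ (-(3 / 8) : ℝ) := by positivity
  rw [← hsum.tsum_eq, ← Real.norm_eq_abs]
  refine (tsum_of_norm_bounded hmaj fun d => ?_).trans (mul_le_mul_of_nonneg_right
    (Real.tsum_le_of_sum_le (psiCoeffAbs_nonneg n) (sum_psiCoeffAbs_le hn)) hpos)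
  rcases Nat.eq_zero_or_pos d with rfl | hd
  · simp [psiCoeffAbs]
  have hd0 : (0 : ℝ) < d := by exact_mod_cast hd
  rw [← mul_sub, ← mul_sub, sum_Ioc_zero_sub (Nat.div_le_div_right hle),
    ← Nat.floor_div_natCast, ← Nat.floor_div_natCast, norm_mul, Real.norm_eq_abs, Real.norm_eq_abs]
  have h := abs_sum_Ioc_inv_sub_log_le (u := a / d) (v := b / d) (by positivity) (by gcongr)
    (by rw [← mul_div_assoc]; gcongr)
  rw [div_div_div_cancel_right₀ hd0.ne', Real.div_rpow ha.le hd0.le] at h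
  refine (mul_le_mul_of_nonneg_left h (abs_nonneg _)).trans (le_of_eq ?_)
  rw [abs_mul, abs_of_nonneg (by positivity : 0 ≤ (d : ℝ)⁻¹), psiCoeffAbs,
    show (-(5 / 8) : ℝ) = -1 - -(3 / 8) by norm_num, Real.rpow_sub hd0, Real.rpow_neg_one]
  ring

theorem stmt13 :
    ∃ C > (0 : ℝ), ∀ n : ℕ, 1 ≤ n → ∀ y : ℝ, 3 ≤ y →
      ∀ j : ℕ, 1 ≤ j → (j : ℝ) ≤ y ^ ((1 : ℝ) / 4) →
        |(∑ δ ∈ (Finset.Ioc ⌊y / ((j : ℝ) + 1)⌋₊ ⌊y / (j : ℝ)⌋₊).filter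
              (fun δ : ℕ => Nat.gcd δ n = 1),
            (δ : ℝ) * (ArithmeticFunction.moebius δ : ℝ) ^ 2 / (psi δ : ℝ) ^ 2) -
          Bconst * Real.log (1 + 1 / (j : ℝ)) * alpha n| ≤
        C * rfun n * (j : ℝ) ^ ((3 : ℝ) / 8) / y ^ ((3 : ℝ) / 8) := by
  refine ⟨4 * Real.exp (∑' k : ℕ, 3 * (k : ℝ) ^ (-(5 / 4) : ℝ)), by positivity, ?_⟩
  intro n hn y hy j hj _
  have hj1 : (1 : ℝ) ≤ j := by exact_mod_cast hj
  have hj0 : (0 : ℝ) < j := by linarith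
  have hy0 : 0 < y := by linarith
  have h := abs_sum_psiWeight_sub_le (n := n) (by omega) (a := y / (j + 1)) (b := y / j)
    (by positivity) (by gcongr; linarith)
    (by rw [← mul_div_assoc, div_le_div_iff₀ hj0 (by positivity)]; nlinarith)
  have hratio : y / j / (y / (j + 1)) = 1 + 1 / (j : ℝ) := by field_simp
  have hsum : ∑ δ ∈ (Finset.Ioc ⌊y / ((j : ℝ) + 1)⌋₊ ⌊y / (j : ℝ)⌋₊).filter
        (fun δ : ℕ => Nat.gcd δ n = 1),
        (δ : ℝ) * (ArithmeticFunction.moebius δ : ℝ) ^ 2 / (psi δ : ℝ) ^ 2 =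
      ∑ δ ∈ Finset.Ioc ⌊y / ((j : ℝ) + 1)⌋₊ ⌊y / (j : ℝ)⌋₊, psiWeight n δ * (δ : ℝ)⁻¹ := by
    rw [Finset.sum_filter]
    refine Finset.sum_congr rfl fun δ hδ => ?_
    have hδ0 : (δ : ℝ) ≠ 0 := by
      rw [Finset.mem_Ioc] at hδ
      exact_mod_cast (by omega : δ ≠ 0)
    rw [psiWeight_apply]
    split_ifs
    · field_simp
    · simp
  rw [hratio] at h
  rw [hsum, mul_right_comm Bconst]
  refine h.trans ?_
  have hr : 0 ≤ rfun n := Finset.prod_nonneg fun p _ => by positivity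
  have hpow : (y / (j + 1)) ^ (-(3 / 8) : ℝ) ≤ 2 * ((j : ℝ) ^ ((3 : ℝ) / 8) / y ^ ((3 : ℝ) / 8)) := by
    rw [Real.rpow_neg (by positivity), ← Real.inv_rpow (by positivity), inv_div,
      Real.div_rpow (by positivity) hy0.le, ← mul_div_assoc]
    gcongr
    calc ((j : ℝ) + 1) ^ ((3 : ℝ) / 8) ≤ (2 * j) ^ ((3 : ℝ) / 8) := by gcongr; linarith
      _ = 2 ^ ((3 : ℝ) / 8) * (j : ℝ) ^ ((3 : ℝ) / 8) := Real.mul_rpow (by norm_num) hj0.le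
      _ ≤ 2 ^ (1 : ℝ) * (j : ℝ) ^ ((3 : ℝ) / 8) := by gcongr <;> norm_num
      _ = 2 * (j : ℝ) ^ ((3 : ℝ) / 8) := by rw [Real.rpow_one]
  calc _ ≤ Real.exp (∑' k : ℕ, 3 * (k : ℝ) ^ (-(5 / 4) : ℝ)) * rfun n *
        (2 * (2 * ((j : ℝ) ^ ((3 : ℝ) / 8) / y ^ ((3 : ℝ) / 8)))) := by gcongr
    _ = _ := by ring
end
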